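/- arXiv:1202.3219 — 4 statements merged into one kernel-verified Lean document; each statement's English description precedes it below -/
import Mathlib

section
/- Let m be a square-free positive integer with m ≠ 1 and m ≠ 3, let 𝓞 be the ring of integers of ℚ(√-m), and let ω ∈ 𝓞 be an element such that 𝓞 = ℤ[ω] (i.e. {1, ω} is a ℤ-basis of 𝓞). Then the matrix [[1,ω],[0,1]] represents a non-trivial element of the abelianization (commutator factor group) of the Bianchi group SL₂(𝓞). -/
open NumberField Matrix

/-- A function on a `G`-set that each `g : G` changes at only finitely many points defines a
homomorphism `G → ℤ`, summing up all the changes. -/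
noncomputable def sumOfChanges {G X : Type*} [Group G] (ρ : G →* Equiv.Perm X) (f : X → ℤ)
    (hf : ∀ g, (Function.support fun x => f (ρ g x) - f x).Finite) :
    G →* Multiplicative ℤ where
  toFun g := Multiplicative.ofAdd (∑ᶠ x, (f (ρ g x) - f x))
  map_one' := by simp
  map_mul' g h := by
    rw [← ofAdd_add]
    congr 1
    have key : ∀ x, f (ρ (g * h) x) - f x =
        (f (ρ g (ρ h x)) - f (ρ h x)) + (f (ρ h x) - f x) := fun x => by simp
    rw [finsum_congr key, finsum_add_distrib _ (hf h)]
    · rw [← finsum_comp_equiv (ρ h) (f := fun x => f (ρ g x) - f x)]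
    · exact (hf g).preimage (f := ρ h) (ρ h).injective.injOn

theorem Abelianization.of_ne_one_of_finsum_ne_zero {G X : Type*} [Group G]
    (ρ : G →* Equiv.Perm X) (f : X → ℤ)
    (hf : ∀ g, (Function.support fun x => f (ρ g x) - f x).Finite) {g : G}
    (hg : ∑ᶠ x, (f (ρ g x) - f x) ≠ 0) : Abelianization.of g ≠ 1 := by
  intro h
  have h1 := congrArg (Abelianization.lift (sumOfChanges ρ f hf)) h
  rw [Abelianization.lift_apply_of, map_one] at h1
  exact hg (congrArg Multiplicative.toAdd h1)

/-- The action `M ↦ g * M * gᴴ` of `SL₂(ℂ)` on `2 × 2` matrices. -/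
noncomputable def hermitianCongr :
    SpecialLinearGroup (Fin 2) ℂ →* Equiv.Perm (Matrix (Fin 2) (Fin 2) ℂ) where
  toFun g :=
    { toFun := fun M => g.1 * M * g.1ᴴ
      invFun := fun M => g⁻¹.1 * M * g⁻¹.1ᴴ
      left_inv := fun M => by
        have h : g⁻¹.1 * g.1 = 1 := congrArg Subtype.val (inv_mul_cancel g)
        calc _ = (g⁻¹.1 * g.1) * M * (g⁻¹.1 * g.1)ᴴ := by
              simp only [conjTranspose_mul, Matrix.mul_assoc]
          _ = M := by rw [h, conjTranspose_one, Matrix.mul_one, Matrix.one_mul]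
      right_inv := fun M => by
        have h : g.1 * g⁻¹.1 = 1 := congrArg Subtype.val (mul_inv_cancel g)
        calc _ = (g.1 * g⁻¹.1) * M * (g.1 * g⁻¹.1)ᴴ := by
              simp only [conjTranspose_mul, Matrix.mul_assoc]
          _ = M := by rw [h, conjTranspose_one, Matrix.mul_one, Matrix.one_mul] }
  map_one' := by ext1 M; simp
  map_mul' g h := by ext1 M; simp [conjTranspose_mul, Matrix.mul_assoc]

theorem hermitianCongr_apply (g : SpecialLinearGroup (Fin 2) ℂ) (M : Matrix (Fin 2) (Fin 2) ℂ) :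
    hermitianCongr g M = g.1 * M * g.1ᴴ :=
  rfl

theorem hermitianCongr_inv_apply (g : SpecialLinearGroup (Fin 2) ℂ)
    (M : Matrix (Fin 2) (Fin 2) ℂ) : hermitianCongr g⁻¹ (hermitianCongr g M) = M :=
  (hermitianCongr g).symm_apply_apply M

/-- The trace and norm of `w : ℂ` over `ℝ` are the integers `s` and `n`, and `s² - 4n < -4`. -/
structure IsQuadraticInteger (w : ℂ) (s n : ℤ) : Prop where
  add_conj : w + star w = s
  mul_conj : w * star w = n
  disc : 4 < 4 * n - s ^ 2

/-- The lattice `ℤ + ℤw`. -/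
def quadLattice (w : ℂ) : Set ℂ := {u | ∃ x y : ℤ, u = x + y * w}

namespace IsQuadraticInteger

variable {w : ℂ} {s n : ℤ}

theorem star_eq (hw : IsQuadraticInteger w s n) : star w = s - w := by
  rw [← hw.add_conj]; ring

theorem sq_eq (hw : IsQuadraticInteger w s n) : w ^ 2 = s * w - n := by
  rw [← hw.add_conj, ← hw.mul_conj]; ring

theorem diff_sq (hw : IsQuadraticInteger w s n) :
    (w - star w) ^ 2 = -((4 * n - s ^ 2 : ℤ) : ℂ) := by
  rw [hw.star_eq]; push_cast; linear_combination 4 * hw.sq_eq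

theorem diff_ne_zero (hw : IsQuadraticInteger w s n) : w - star w ≠ 0 := by
  intro h
  have h1 := hw.diff_sq
  rw [h, zero_pow two_ne_zero, eq_comm, neg_eq_zero, Int.cast_eq_zero] at h1
  have := hw.disc
  omega

theorem add_mem {u v : ℂ} (hu : u ∈ quadLattice w) (hv : v ∈ quadLattice w) :
    u + v ∈ quadLattice w := by
  obtain ⟨x, y, rfl⟩ := hu
  obtain ⟨x', y', rfl⟩ := hv
  exact ⟨x + x', y + y', by push_cast; ring⟩

theorem mul_mem (hw : IsQuadraticInteger w s n) {u v : ℂ} (hu : u ∈ quadLattice w)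
    (hv : v ∈ quadLattice w) : u * v ∈ quadLattice w := by
  obtain ⟨x, y, rfl⟩ := hu
  obtain ⟨x', y', rfl⟩ := hv
  exact ⟨x * x' - n * y * y', x * y' + y * x' + s * y * y', by
    push_cast; linear_combination (y * y' : ℂ) * hw.sq_eq⟩

theorem star_diff_inv (w : ℂ) : star (w - star w)⁻¹ = -(w - star w)⁻¹ := by
  rw [star_inv₀, star_sub, star_star, ← neg_sub w, inv_neg]

theorem star_mem (hw : IsQuadraticInteger w s n) {u : ℂ} (hu : u ∈ quadLattice w) :
    star u ∈ quadLattice w := by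
  obtain ⟨x, y, rfl⟩ := hu
  exact ⟨x + s * y, -y, by
    rw [star_add, star_mul', hw.star_eq]; simp; ring⟩

theorem intCast_mem (w : ℂ) (k : ℤ) : (k : ℂ) ∈ quadLattice w := ⟨k, 0, by simp⟩

theorem exists_add_star (hw : IsQuadraticInteger w s n) {u : ℂ} (hu : u ∈ quadLattice w) :
    ∃ k : ℤ, u + star u = k := by
  obtain ⟨x, y, rfl⟩ := hu
  exact ⟨2 * x + s * y, by rw [star_add, star_mul', hw.star_eq]; simp; ring⟩

theorem exists_sub_star {u : ℂ} (hu : u ∈ quadLattice w) :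
    ∃ k : ℤ, u - star u = k * (w - star w) := by
  obtain ⟨x, y, rfl⟩ := hu
  exact ⟨y, by rw [star_add, star_mul']; simp; ring⟩

theorem exists_mul_star (hw : IsQuadraticInteger w s n) {u : ℂ} (hu : u ∈ quadLattice w) :
    ∃ k : ℤ, u * star u = k := by
  obtain ⟨x, y, rfl⟩ := hu
  exact ⟨x ^ 2 + s * x * y + n * y ^ 2, by
    rw [star_add, star_mul', hw.star_eq]; simp
    linear_combination (-(y : ℂ) ^ 2) * hw.sq_eq⟩

end IsQuadraticInteger

/-- An invariant set of indefinite Hermitian forms, each vanishing on a plane of hyperbolic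
3-space; the congruence condition on the off-diagonal entry picks one form from `{M, -M}`. -/
structure IsPlaneForm (w : ℂ) (M : Matrix (Fin 2) (Fin 2) ℂ) : Prop where
  herm : Mᴴ = M
  det_eq : M.det = ((w - star w)⁻¹) ^ 2
  int₀ : ∃ A : ℤ, M 0 0 = A
  int₁ : ∃ C : ℤ, M 1 1 = C
  mem : M 0 1 - (w - star w)⁻¹ ∈ quadLattice w

namespace IsPlaneForm

variable {w : ℂ} {s n : ℤ} {M : Matrix (Fin 2) (Fin 2) ℂ}

theorem exists_normal_form (hw : IsQuadraticInteger w s n) (hM : IsPlaneForm w M) :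
    ∃ A C x y : ℤ, M = !![(A : ℂ), x + y * w + (w - star w)⁻¹;
      x + y * star w - (w - star w)⁻¹, C] ∧
      (2 * x + s * y) ^ 2 + (4 * n - s ^ 2) * y ^ 2 - 4 * y = 4 * (A * C) := by
  obtain ⟨A, hA⟩ := hM.int₀
  obtain ⟨C, hC⟩ := hM.int₁
  obtain ⟨x, y, hxy⟩ := hM.mem
  have h01 : M 0 1 = x + y * w + (w - star w)⁻¹ := by rw [← hxy]; ring
  have h10 : M 1 0 = x + y * star w - (w - star w)⁻¹ := by
    rw [← hM.herm, conjTranspose_apply, h01, star_add, star_add, star_mul',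
      IsQuadraticInteger.star_diff_inv]
    simp; ring
  refine ⟨A, C, x, y, ?_, ?_⟩
  · rw [← hA, ← hC, ← h01, ← h10]; exact Matrix.eta_fin_two M
  · have h := hM.det_eq
    have hd := hw.diff_ne_zero
    rw [det_fin_two, hA, hC, h01, h10] at h
    have hi : (w - star w) * (w - star w)⁻¹ = 1 := mul_inv_cancel₀ hd
    have : ((2 * x + s * y) ^ 2 + (4 * n - s ^ 2) * y ^ 2 - 4 * y : ℂ) = 4 * (A * C) := by
      have h2 : (x + y * w) * (x + y * star w) = (x ^ 2 + s * x * y + n * y ^ 2 : ℂ) := by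
        linear_combination (x * y : ℂ) * hw.add_conj + (y : ℂ) ^ 2 * hw.mul_conj
      linear_combination (-4 : ℂ) * h - 4 * h2 + 4 * (y : ℂ) * hi
    exact_mod_cast this

theorem congr (hw : IsQuadraticInteger w s n) (hM : IsPlaneForm w M)
    (g : SpecialLinearGroup (Fin 2) ℂ) (hg : ∀ i j, g.1 i j ∈ quadLattice w) :
    IsPlaneForm w (hermitianCongr g M) := by
  have hd := hw.diff_ne_zero
  have hi : (w - star w) * (w - star w)⁻¹ = 1 := mul_inv_cancel₀ hd
  obtain ⟨A, hA⟩ := hM.int₀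
  obtain ⟨C, hC⟩ := hM.int₁
  have hγ := hM.mem
  obtain ⟨γ, hγ_def⟩ : ∃ γ, γ = M 0 1 - (w - star w)⁻¹ := ⟨_, rfl⟩
  rw [← hγ_def] at hγ
  have h01 : M 0 1 = γ + (w - star w)⁻¹ := by rw [hγ_def]; ring
  have h10 : M 1 0 = star γ - (w - star w)⁻¹ := by
    rw [← hM.herm, conjTranspose_apply, h01, star_add,
      IsQuadraticInteger.star_diff_inv]
    ring
  have entry : ∀ i j, hermitianCongr g M i j =
      A * (g.1 i 0 * star (g.1 j 0)) + (γ + (w - star w)⁻¹) * (g.1 i 0 * star (g.1 j 1)) +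
      (star γ - (w - star w)⁻¹) * (g.1 i 1 * star (g.1 j 0)) +
      C * (g.1 i 1 * star (g.1 j 1)) := by
    intro i j
    rw [hermitianCongr_apply, ← h01, ← h10, ← hA, ← hC]
    simp only [Matrix.mul_apply, Fin.sum_univ_two, conjTranspose_apply]
    ring
  have diag : ∀ i, ∃ k : ℤ, hermitianCongr g M i i = k := by
    intro i
    obtain ⟨k₁, h₁⟩ := hw.exists_mul_star (hg i 0)
    obtain ⟨k₂, h₂⟩ := hw.exists_mul_star (hg i 1)
    have hu := hw.mul_mem (hg i 0) (hw.star_mem (hg i 1))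
    obtain ⟨k₃, h₃⟩ := hw.exists_add_star (hw.mul_mem hγ hu)
    obtain ⟨k₄, h₄⟩ := IsQuadraticInteger.exists_sub_star hu
    refine ⟨A * k₁ + k₃ + k₄ + C * k₂, ?_⟩
    rw [entry]
    simp only [star_mul', star_star] at h₃ h₄
    push_cast
    linear_combination (A : ℂ) * h₁ + h₃ + (w - star w)⁻¹ * h₄ + (C : ℂ) * h₂ + (k₄ : ℂ) * hi
  refine ⟨?_, ?_, diag 0, diag 1, ?_⟩
  · rw [hermitianCongr_apply, conjTranspose_mul, conjTranspose_mul, conjTranspose_conjTranspose,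
      hM.herm, Matrix.mul_assoc]
  · rw [hermitianCongr_apply, det_mul, det_mul, det_conjTranspose, g.2, star_one, one_mul, mul_one,
      hM.det_eq]
  · obtain ⟨k₁, h₁⟩ := IsQuadraticInteger.exists_sub_star (hg 1 1)
    obtain ⟨k₂, h₂⟩ := IsQuadraticInteger.exists_sub_star (hg 1 0)
    have hdet : g.1 0 0 * g.1 1 1 - g.1 0 1 * g.1 1 0 = 1 := by rw [← det_fin_two]; exact g.2
    have : hermitianCongr g M 0 1 - (w - star w)⁻¹ =
        A * (g.1 0 0 * star (g.1 1 0)) + γ * (g.1 0 0 * star (g.1 1 1)) +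
        star γ * (g.1 0 1 * star (g.1 1 0)) + C * (g.1 0 1 * star (g.1 1 1)) +
        ((-k₁ : ℤ) * g.1 0 0 + k₂ * g.1 0 1) := by
      rw [entry]
      push_cast
      linear_combination (w - star w)⁻¹ * hdet - g.1 0 0 * (w - star w)⁻¹ * h₁ +
        g.1 0 1 * (w - star w)⁻¹ * h₂ + (k₂ * g.1 0 1 - k₁ * g.1 0 0) * hi
    rw [this]
    have hI := IsQuadraticInteger.intCast_mem w
    have hs := fun i j => hw.star_mem (hg i j)
    have hadd := fun u v => IsQuadraticInteger.add_mem (w := w) (u := u) (v := v)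
    have hmul := fun u v => hw.mul_mem (u := u) (v := v)
    exact hadd _ _ (hadd _ _ (hadd _ _ (hadd _ _
      (hmul _ _ (hI A) (hmul _ _ (hg _ _) (hs _ _)))
      (hmul _ _ hγ (hmul _ _ (hg _ _) (hs _ _))))
      (hmul _ _ (hw.star_mem hγ) (hmul _ _ (hg _ _) (hs _ _))))
      (hmul _ _ (hI C) (hmul _ _ (hg _ _) (hs _ _))))
      (hadd _ _ (hmul _ _ (hI _) (hg _ _)) (hmul _ _ (hI _) (hg _ _)))

end IsPlaneForm

/-- If a form `(A, B, C)` has positive trace, small `|B|² - AC = E`, and is nonpositive against a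
positive definite form `(p, q, r)` of determinant one, with `X = 2 Re (B q)`, then its diagonal
entries are bounded. -/
theorem diagonal_bound {A C : ℤ} {p r E X : ℝ} (hp : 0 < p) (hr : 0 < r) (hpr : 1 ≤ p * r)
    (hE1 : E < 1) (hB : 0 ≤ A * C + E) (hX : X ^ 2 ≤ 4 * (A * C + E) * (p * r - 1))
    (hpos : 0 < A + C) (hneg : A * p + C * r + X ≤ 0) :
    (0 ≤ A ∧ 0 ≤ C) ∧ A * p ≤ 4 * E * (p * r) ^ 2 + 1 ∧ C * r ≤ 4 * E * (p * r) ^ 2 + 1 := by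
  have hAC : 0 ≤ A * C := by
    have : (-1 : ℝ) < ((A * C : ℤ) : ℝ) := by push_cast; linarith
    have : (-1 : ℤ) < A * C := by exact_mod_cast this
    omega
  have hnn : 0 ≤ A ∧ 0 ≤ C := by
    constructor
    · by_contra! h
      have : 0 < C := by omega
      nlinarith
    · by_contra! h
      have : 0 < A := by omega
      nlinarith
  obtain ⟨hA, hC⟩ := hnn
  have hA' : (0 : ℝ) ≤ A := by exact_mod_cast hA
  have hC' : (0 : ℝ) ≤ C := by exact_mod_cast hC
  have hAp : 0 ≤ A * p := by positivity
  have hCr : 0 ≤ C * r := by positivity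
  have hsq : (A * p + C * r) ^ 2 ≤ 4 * (A * C + E) * (p * r - 1) := by
    refine le_trans ?_ hX
    nlinarith
  have hACle : (A * C : ℝ) ≤ E * (p * r - 1) := by
    nlinarith [sq_nonneg (A * p - C * r)]
  have hV : (A * p + C * r) ^ 2 ≤ 4 * E * (p * r) ^ 2 := by
    calc _ ≤ 4 * (A * C + E) * (p * r - 1) := hsq
      _ ≤ 4 * (E * (p * r)) * (p * r - 1) := by
        gcongr
        linarith
      _ ≤ 4 * E * (p * r) ^ 2 := by nlinarith [sq_nonneg (p * r)]
  refine ⟨⟨hA, hC⟩, ?_, ?_⟩ <;> nlinarith [sq_nonneg (A * p - 1), sq_nonneg (C * r - 1)]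

namespace IsPlaneForm

variable {w : ℂ} {s n : ℤ} {M : Matrix (Fin 2) (Fin 2) ℂ}

theorem apply_one_zero (hM : IsPlaneForm w M) : M 1 0 = star (M 0 1) := by
  rw [← conjTranspose_apply, hM.herm]

theorem normSq_eq (hw : IsQuadraticInteger w s n) (hM : IsPlaneForm w M) {A C : ℤ}
    (hA : M 0 0 = A) (hC : M 1 1 = C) :
    Complex.normSq (M 0 1) = A * C + ((4 * n - s ^ 2 : ℤ) : ℝ)⁻¹ := by
  have h := hM.det_eq
  rw [det_fin_two, hM.apply_one_zero, hA, hC, inv_pow, hw.diff_sq, ← starRingEnd_apply,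
    Complex.mul_conj, inv_neg] at h
  have h2 : ((Complex.normSq (M 0 1) : ℝ) : ℂ) =
      ((A * C + ((4 * n - s ^ 2 : ℤ) : ℝ)⁻¹ : ℝ) : ℂ) := by
    rw [Complex.ofReal_add, Complex.ofReal_inv, Complex.ofReal_intCast]
    push_cast at h ⊢
    linear_combination -h
  exact_mod_cast h2

theorem finite_of_diagonal_le (hw : IsQuadraticInteger w s n) (N : ℤ) :
    {M | IsPlaneForm w M ∧ ∃ A C : ℤ, M 0 0 = A ∧ M 1 1 = C ∧ (0 ≤ A ∧ A ≤ N) ∧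
      (0 ≤ C ∧ C ≤ N)}.Finite := by
  let F : ℤ × ℤ × ℤ × ℤ → Matrix (Fin 2) (Fin 2) ℂ := fun v =>
    !![(v.1 : ℂ), v.2.2.1 + v.2.2.2 * w + (w - star w)⁻¹;
      v.2.2.1 + v.2.2.2 * star w - (w - star w)⁻¹, v.2.1]
  let R : ℤ := 2 * N * |s| + 2 * N + 2
  refine (((Set.finite_Icc 0 N).prod ((Set.finite_Icc 0 N).prod ((Set.finite_Icc (-R) R).prod
    (Set.finite_Icc (-(2 * N)) (2 * N))))).image F).subset ?_
  rintro M ⟨hM, A', C', hA', hC', ⟨hA0, hAN⟩, hC0, hCN⟩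
  obtain ⟨A, C, x, y, rfl, h⟩ := hM.exists_normal_form hw
  have e1 : A = A' := by simpa using hA'
  have e2 : C = C' := by simpa using hC'
  subst e1 e2
  have hd := hw.disc
  have hN : 0 ≤ N := hA0.trans hAN
  have hy0 : 0 ≤ y ^ 2 - y := by
    rcases le_or_gt y 0 with h | h <;> nlinarith
  have hAC : A * C ≤ N * N := mul_le_mul hAN hCN hC0 hN
  have hyy : y ^ 2 ≤ (2 * N) ^ 2 := by
    nlinarith [mul_nonneg (sub_nonneg.2 (Int.add_one_le_of_lt hd)) (sq_nonneg y),
      sq_nonneg (2 * x + s * y)]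
  have hy : |y| ≤ 2 * N := abs_le_of_sq_le_sq hyy (by omega)
  have hx2 : (2 * x + s * y) ^ 2 ≤ (2 * N + 2) ^ 2 := by
    nlinarith [mul_nonneg (sub_nonneg.2 hd.le) (sq_nonneg y), le_abs_self y]
  have hx : |2 * x + s * y| ≤ 2 * N + 2 := abs_le_of_sq_le_sq hx2 (by omega)
  have hsy : |s * y| ≤ 2 * N * |s| := by
    rw [abs_mul, mul_comm]; gcongr
  have hR : |x| ≤ R := by
    have h0 := abs_nonneg (s * y)
    have := abs_le.1 hx
    have := abs_le.1 hsy
    rw [abs_le]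
    constructor <;> simp only [R] <;> omega
  exact ⟨(A, C, x, y), ⟨⟨hA0, hAN⟩, ⟨hC0, hCN⟩, abs_le.1 hR, abs_le.1 hy⟩, rfl⟩

theorem finite_sign_change (hw : IsQuadraticInteger w s n) (g : SpecialLinearGroup (Fin 2) ℂ) :
    {M | IsPlaneForm w M ∧ 0 < M.trace.re ∧ (hermitianCongr g M).trace.re ≤ 0}.Finite := by
  set p : ℝ := Complex.normSq (g.1 0 0) + Complex.normSq (g.1 1 0) with hp_def
  set r : ℝ := Complex.normSq (g.1 0 1) + Complex.normSq (g.1 1 1) with hr_def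
  set q : ℂ := g.1 0 0 * star (g.1 0 1) + g.1 1 0 * star (g.1 1 1) with hq_def
  set E : ℝ := ((4 * n - s ^ 2 : ℤ) : ℝ)⁻¹ with hE_def
  have hd : (1 : ℝ) < ((4 * n - s ^ 2 : ℤ) : ℝ) := by
    have := hw.disc
    exact_mod_cast (by omega : 1 < 4 * n - s ^ 2)
  have hE1 : E < 1 := inv_lt_one_of_one_lt₀ hd
  have hdet : g.1 0 0 * g.1 1 1 - g.1 0 1 * g.1 1 0 = 1 := by rw [← det_fin_two]; exact g.2
  have hpr : p * r - 1 = Complex.normSq q := by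
    have h1 := congrArg Complex.re hdet
    have h2 := congrArg Complex.im hdet
    simp only [Complex.sub_re, Complex.mul_re, Complex.sub_im, Complex.mul_im, Complex.one_re,
      Complex.one_im] at h1 h2
    simp only [hp_def, hr_def, hq_def, Complex.normSq_apply, Complex.add_re, Complex.add_im,
      Complex.mul_re, Complex.mul_im, Complex.star_def, Complex.conj_re, Complex.conj_im]
    set a := (g.1 0 0).re
    set a' := (g.1 0 0).im
    set b := (g.1 0 1).re
    set b' := (g.1 0 1).im
    set c := (g.1 1 0).re
    set c' := (g.1 1 0).im
    set d := (g.1 1 1).re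
    set d' := (g.1 1 1).im
    linear_combination (a * d - a' * d' - (b * c - b' * c') + 1) * h1 +
      (a * d' + a' * d - (b * c' + b' * c)) * h2
  have hpr1 : 1 ≤ p * r := by linarith [Complex.normSq_nonneg q]
  have hp0 : 0 ≤ p := add_nonneg (Complex.normSq_nonneg _) (Complex.normSq_nonneg _)
  have hr0 : 0 ≤ r := add_nonneg (Complex.normSq_nonneg _) (Complex.normSq_nonneg _)
  have hp : 0 < p := hp0.lt_of_ne fun h => by rw [← h] at hpr1; linarith
  have hr : 0 < r := hr0.lt_of_ne fun h => by rw [← h] at hpr1; linarith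
  set V : ℝ := 4 * E * (p * r) ^ 2 + 1 with hV_def
  refine (finite_of_diagonal_le hw (max ⌈V / p⌉ ⌈V / r⌉)).subset ?_
  rintro M ⟨hM, hpos, hneg⟩
  refine ⟨hM, ?_⟩
  obtain ⟨A, hA⟩ := hM.int₀
  obtain ⟨C, hC⟩ := hM.int₁
  have hB := hM.normSq_eq hw hA hC
  have hpos' : 0 < A + C := by
    rw [trace_fin_two, hA, hC] at hpos
    have : (0 : ℝ) < (A : ℝ) + C := by simpa using hpos
    exact_mod_cast this
  have htr : (hermitianCongr g M).trace.re = A * p + C * r + 2 * (M 0 1 * q).re := by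
    rw [hermitianCongr_apply, trace_fin_two]
    simp only [Matrix.mul_apply, Fin.sum_univ_two, conjTranspose_apply, hA, hC,
      hM.apply_one_zero]
    simp only [hp_def, hr_def, hq_def, Complex.normSq_apply, Complex.add_re, Complex.add_im,
      Complex.mul_re, Complex.mul_im, Complex.star_def, Complex.conj_re, Complex.conj_im,
      Complex.intCast_re, Complex.intCast_im]
    ring
  have hX : (2 * (M 0 1 * q).re) ^ 2 ≤ 4 * (A * C + E) * (p * r - 1) := by
    rw [hpr, ← hB, mul_assoc, ← Complex.normSq_mul, Complex.normSq_apply]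
    nlinarith [sq_nonneg (M 0 1 * q).im]
  obtain ⟨⟨hA0, hC0⟩, h1, h2⟩ := diagonal_bound hp hr hpr1 hE1
    (hB ▸ Complex.normSq_nonneg _) hX hpos' (htr ▸ hneg)
  refine ⟨A, C, hA, hC, ⟨hA0, le_max_of_le_left ?_⟩, ⟨hC0, le_max_of_le_right ?_⟩⟩
  · have : (A : ℝ) ≤ ⌈V / p⌉ := ((le_div_iff₀ hp).2 h1).trans (Int.le_ceil _)
    exact_mod_cast this
  · have : (C : ℝ) ≤ ⌈V / r⌉ := ((le_div_iff₀ hr).2 h2).trans (Int.le_ceil _)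
    exact_mod_cast this

end IsPlaneForm

namespace IsPlaneForm

variable {w : ℂ} {s n : ℤ} {M : Matrix (Fin 2) (Fin 2) ℂ}

theorem congr_iff (hw : IsQuadraticInteger w s n)
    (g : SpecialLinearGroup (Fin 2) ℂ) (hg : ∀ i j, g.1 i j ∈ quadLattice w)
    (hg' : ∀ i j, g⁻¹.1 i j ∈ quadLattice w) :
    IsPlaneForm w (hermitianCongr g M) ↔ IsPlaneForm w M := by
  refine ⟨fun h => ?_, fun h => h.congr hw g hg⟩
  have := h.congr hw g⁻¹ hg'
  rwa [hermitianCongr_inv_apply] at this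

theorem trace_pos_iff (hw : IsQuadraticInteger w s n) (hM : IsPlaneForm w M) {C : ℤ}
    (hC : M 1 1 = C) (hC0 : C ≠ 0) : 0 < M.trace.re ↔ 0 < C := by
  obtain ⟨A, C', x, y, rfl, h⟩ := hM.exists_normal_form hw
  obtain rfl : C' = C := by simpa using hC
  have hd := hw.disc
  have hAC : 0 ≤ A * C' := by
    have hy0 : 0 ≤ y ^ 2 - y := by
      rcases le_or_gt y 0 with h | h <;> nlinarith
    nlinarith [mul_nonneg (sub_nonneg.2 hd.le) (sq_nonneg y), sq_nonneg (2 * x + s * y)]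
  have htr : (!![(A : ℂ), x + y * w + (w - star w)⁻¹;
      x + y * star w - (w - star w)⁻¹, C']).trace.re = ((A + C' : ℤ) : ℝ) := by
    simp [trace_fin_two]
  rw [htr, Int.cast_pos]
  constructor
  · intro h1
    by_contra! h2
    have : C' < 0 := lt_of_le_of_ne h2 hC0
    nlinarith
  · intro h1
    have : 0 ≤ A := nonneg_of_mul_nonneg_left hAC h1
    omega

theorem eq_of_apply_one_one_eq_zero (hw : IsQuadraticInteger w s n) (hM : IsPlaneForm w M)
    (hC : M 1 1 = 0) :
    ∃ A : ℤ, M = !![(A : ℂ), (w - star w)⁻¹; -(w - star w)⁻¹, 0] := by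
  obtain ⟨A, C, x, y, rfl, h⟩ := hM.exists_normal_form hw
  obtain rfl : C = 0 := by simpa using hC
  have hd := hw.disc
  have hy : y = 0 := by
    have h1 : 5 * y ^ 2 ≤ 4 * y := by
      nlinarith [mul_nonneg (sub_nonneg.2 (Int.add_one_le_of_lt hd)) (sq_nonneg y),
        sq_nonneg (2 * x + s * y)]
    rcases lt_trichotomy y 0 with h | h | h
    · nlinarith
    · exact h
    · nlinarith
  subst hy
  have hx : x = 0 := by simpa using h
  subst hx
  exact ⟨A, by simp⟩

theorem of_int (w : ℂ) (A : ℤ) :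
    IsPlaneForm w !![(A : ℂ), (w - star w)⁻¹; -(w - star w)⁻¹, 0] where
  herm := by
    have h := IsQuadraticInteger.star_diff_inv w
    ext i j
    fin_cases i <;> fin_cases j <;>
      simp only [conjTranspose_apply, Matrix.of_apply, Fin.zero_eta, Fin.mk_one, cons_val',
        cons_val_zero, cons_val_one, cons_val_fin_one, star_neg, h, star_zero, neg_neg]
    simp
  det_eq := by rw [det_fin_two_of]; ring
  int₀ := ⟨A, rfl⟩
  int₁ := ⟨0, by simp⟩
  mem := ⟨0, 0, by simp⟩

end IsPlaneForm

open Classical in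
/-- The indicator function of the plane forms that are positive at the base point. -/
noncomputable def positiveSide (w : ℂ) (M : Matrix (Fin 2) (Fin 2) ℂ) : ℤ :=
  if IsPlaneForm w M ∧ 0 < M.trace.re then 1 else 0

theorem positiveSide_congr {w : ℂ} {M N : Matrix (Fin 2) (Fin 2) ℂ}
    (h : IsPlaneForm w N ∧ 0 < N.trace.re ↔ IsPlaneForm w M ∧ 0 < M.trace.re) :
    positiveSide w N = positiveSide w M := by
  unfold positiveSide
  split_ifs <;> tauto

theorem Abelianization.of_unipotent_ne_one_of_embedding {R : Type*} [CommRing R] {w : ℂ} {s n : ℤ}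
    (hw : IsQuadraticInteger w s n) (ψ : R →+* ℂ) (hψ : ∀ u, ψ u ∈ quadLattice w) {ω : R}
    (hω : ψ ω = w) (T : SpecialLinearGroup (Fin 2) R) (hT : T.1 = !![1, ω; 0, 1]) :
    Abelianization.of T ≠ 1 := by
  have hplane : ∀ (g : SpecialLinearGroup (Fin 2) R) M,
      IsPlaneForm w (hermitianCongr (SpecialLinearGroup.map ψ g) M) ↔ IsPlaneForm w M :=
    fun g M => IsPlaneForm.congr_iff hw _ (fun i j => hψ (g.1 i j))
      (by rw [← map_inv]; exact fun i j => hψ (g⁻¹.1 i j))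
  refine Abelianization.of_ne_one_of_finsum_ne_zero
    (hermitianCongr.comp (SpecialLinearGroup.map ψ)) (positiveSide w) (fun g => ?_) ?_
  · have h1 := IsPlaneForm.finite_sign_change hw (SpecialLinearGroup.map ψ g)
    have h2 := (IsPlaneForm.finite_sign_change hw (SpecialLinearGroup.map ψ g)⁻¹).preimage
      (f := hermitianCongr (SpecialLinearGroup.map ψ g)) (Equiv.injective _).injOn
    refine (h1.union h2).subset fun M hM => ?_
    rw [Function.mem_support, MonoidHom.comp_apply] at hM
    by_contra! h
    apply hM
    have key : (IsPlaneForm w (hermitianCongr (SpecialLinearGroup.map ψ g) M) ∧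
        0 < (hermitianCongr (SpecialLinearGroup.map ψ g) M).trace.re) ↔
        (IsPlaneForm w M ∧ 0 < M.trace.re) := by
      simp only [Set.mem_union, Set.mem_ofPred_eq, Set.mem_preimage, hplane, hermitianCongr_inv_apply] at h
      rw [hplane]
      grind
    rw [positiveSide_congr key, sub_self]
  · have hTM : ∀ M, hermitianCongr (SpecialLinearGroup.map ψ T) M =
        !![1, w; 0, 1] * M * !![1, w; 0, 1]ᴴ := by
      intro M
      have : (SpecialLinearGroup.map ψ T).1 = !![1, w; 0, 1] := by
        change ψ.mapMatrix T.1 = _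
        rw [hT]
        ext i j
        fin_cases i <;> fin_cases j <;> simp [hω]
      rw [hermitianCongr_apply, this]
    have h11 : ∀ M, hermitianCongr (SpecialLinearGroup.map ψ T) M 1 1 = M 1 1 := by
      intro M
      rw [hTM]
      simp only [Matrix.mul_apply, Fin.sum_univ_two, conjTranspose_apply]
      simp
    have htr : ∀ A : ℤ, (hermitianCongr (SpecialLinearGroup.map ψ T)
        !![(A : ℂ), (w - star w)⁻¹; -(w - star w)⁻¹, 0]).trace.re = ((A - 1 : ℤ) : ℝ) := by
      intro A
      have hi : (w - star w) * (w - star w)⁻¹ = 1 := mul_inv_cancel₀ hw.diff_ne_zero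
      have : (hermitianCongr (SpecialLinearGroup.map ψ T)
          !![(A : ℂ), (w - star w)⁻¹; -(w - star w)⁻¹, 0]).trace = ((A - 1 : ℤ) : ℂ) := by
        rw [trace_fin_two, h11, hTM]
        simp only [Matrix.mul_apply, Fin.sum_univ_two, conjTranspose_apply, Matrix.of_apply,
          cons_val', cons_val_zero, cons_val_one, cons_val_fin_one, star_one]
        push_cast
        linear_combination -hi
      rw [this, Complex.intCast_re]
    have htr' : ∀ A : ℤ, (!![(A : ℂ), (w - star w)⁻¹; -(w - star w)⁻¹, 0]).trace.re = (A : ℝ) := by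
      simp [trace_fin_two]
    rw [finsum_eq_single _ !![((1 : ℤ) : ℂ), (w - star w)⁻¹; -(w - star w)⁻¹, 0]]
    · simp only [MonoidHom.comp_apply, positiveSide, hplane, htr,
        htr', IsPlaneForm.of_int]
      norm_num
    · intro M hM
      rw [MonoidHom.comp_apply, sub_eq_zero]
      refine positiveSide_congr ?_
      rw [hplane]
      refine and_congr_right fun hP => ?_
      obtain ⟨C, hC⟩ := hP.int₁
      rcases eq_or_ne C 0 with rfl | hC0
      · obtain ⟨A, rfl⟩ := hP.eq_of_apply_one_one_eq_zero hw (by simpa using hC)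
        have hA : A ≠ 1 := by rintro rfl; exact hM rfl
        rw [htr, htr', Int.cast_pos, Int.cast_pos]
        omega
      · rw [hP.trace_pos_iff hw hC hC0,
          ((hplane T M).2 hP).trace_pos_iff hw ((h11 M).trans hC) hC0]

theorem exists_isQuadraticInteger {m : ℕ} (hm_pos : 0 < m) (hm_sqfree : Squarefree m)
    (hm1 : m ≠ 1) (hm3 : m ≠ 3) {K : Type*} [Field K] [NumberField K]
    {α : K} (hα : α ^ 2 = -(m : K)) (hgen : Algebra.adjoin ℚ {α} = ⊤)
    {ω : 𝓞 K} (hω : Algebra.adjoin ℤ ({ω} : Set (𝓞 K)) = ⊤) (φ : K →+* ℂ) :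
    ∃ s n : ℤ, IsQuadraticInteger (φ ω) s n ∧ ∀ u : 𝓞 K, φ u ∈ quadLattice (φ ω) := by
  set w := φ ω with hw_def
  have hφα : φ α ^ 2 = -(m : ℂ) := by rw [← map_pow, hα, map_neg, map_natCast]
  have hstar : star (φ α) = -φ α := by
    have h2 : ((φ α).re * (φ α).im) = 0 ∧ (φ α).re ^ 2 - (φ α).im ^ 2 = -m := by
      have h1 := congrArg Complex.im hφα
      have h2 := congrArg Complex.re hφα
      simp [pow_two] at h1 h2
      constructor <;> linarith
    have hmR : (0 : ℝ) < m := by exact_mod_cast hm_pos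
    have hre : (φ α).re = 0 := by
      rcases mul_eq_zero.1 h2.1 with h | h
      · exact h
      · nlinarith [h2.2, sq_nonneg (φ α).re]
    apply Complex.ext <;> simp [hre]
  have hrat : ∀ u : K, ∃ a b : ℚ, u = a + b * α := by
    intro u
    have hu : u ∈ Algebra.adjoin ℚ {α} := hgen ▸ Algebra.mem_top
    induction hu using Algebra.adjoin_induction with
    | mem x hx => exact ⟨0, 1, by simpa using hx⟩
    | algebraMap r => exact ⟨r, 0, by simp⟩
    | add x y _ _ hx hy =>
      obtain ⟨a, b, rfl⟩ := hx
      obtain ⟨c, d, rfl⟩ := hy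
      exact ⟨a + c, b + d, by push_cast; ring⟩
    | mul x y _ _ hx hy =>
      obtain ⟨a, b, rfl⟩ := hx
      obtain ⟨c, d, rfl⟩ := hy
      exact ⟨a * c - b * d * m, a * d + b * c, by
        push_cast; linear_combination (b * d : K) * hα⟩
  have hwint : IsIntegral ℤ w := ω.isIntegral_coe.map φ.toIntAlgHom
  have hwint' : IsIntegral ℤ (star w) := hwint.map (starRingEnd ℂ).toIntAlgHom
  have hint : ∀ a : ℚ, IsIntegral ℤ (a : ℂ) → ∃ k : ℤ, (a : ℂ) = k := by
    intro a ha
    have h : IsIntegral ℤ a := (isIntegral_algebraMap_iff (A := ℚ) (B := ℂ)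
      (algebraMap ℚ ℂ).injective).1 (by simpa using ha)
    obtain ⟨k, hk⟩ := IsIntegrallyClosed.isIntegral_iff.1 h
    exact ⟨k, by rw [← hk]; simp⟩
  obtain ⟨a, b, hab⟩ := hrat (ω : K)
  have hwab : w = a + b * φ α := by rw [hw_def, hab]; simp
  have hwab' : star w = a - b * φ α := by
    rw [hwab, star_add, star_mul', hstar]; simp; ring
  obtain ⟨s, hs⟩ := hint (2 * a) (by
    have : ((2 * a : ℚ) : ℂ) = w + star w := by rw [hwab', hwab]; push_cast; ring
    rw [this]; exact hwint.add hwint')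
  obtain ⟨n, hn⟩ := hint (a ^ 2 + b ^ 2 * m) (by
    have : ((a ^ 2 + b ^ 2 * m : ℚ) : ℂ) = w * star w := by
      rw [hwab', hwab]; push_cast; linear_combination (b : ℂ) ^ 2 * hφα
    rw [this]; exact hwint.mul hwint')
  have hadd : w + star w = s := by rw [← hs, hwab', hwab]; push_cast; ring
  have hmul : w * star w = n := by
    rw [← hn, hwab', hwab]; push_cast; linear_combination -(b : ℂ) ^ 2 * hφα
  have hsq : w ^ 2 = s * w - n := by rw [← hadd, ← hmul]; ring
  have hlat : ∀ u : 𝓞 K, φ u ∈ quadLattice w := by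
    intro u
    have hu : u ∈ Algebra.adjoin ℤ {ω} := hω ▸ Algebra.mem_top
    induction hu using Algebra.adjoin_induction with
    | mem x hx => exact ⟨0, 1, by rw [Set.mem_singleton_iff.1 hx]; simp [hw_def]⟩
    | algebraMap r => exact ⟨r, 0, by simp⟩
    | add x y _ _ hx hy =>
      obtain ⟨a, b, hx⟩ := hx
      obtain ⟨c, d, hy⟩ := hy
      exact ⟨a + c, b + d, by push_cast; rw [map_add, hx, hy]; ring⟩
    | mul x y _ _ hx hy =>
      obtain ⟨a, b, hx⟩ := hx
      obtain ⟨c, d, hy⟩ := hy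
      exact ⟨a * c - n * b * d, a * d + b * c + s * b * d, by
        push_cast; rw [map_mul, hx, hy]; linear_combination (b * d : ℂ) * hsq⟩
  refine ⟨s, n, ⟨hadd, hmul, ?_⟩, hlat⟩
  have hαint : IsIntegral ℤ α :=
    ⟨Polynomial.X ^ 2 + Polynomial.C (m : ℤ), Polynomial.monic_X_pow_add_C _ two_ne_zero, by
      simp [hα]⟩
  obtain ⟨x, y, hxy⟩ := hlat ⟨α, hαint⟩
  change φ α = x + y * w at hxy
  have hdisc : (4 * m : ℤ) = y ^ 2 * (4 * n - s ^ 2) := by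
    have h1 : star (φ α) = x + y * star w := by rw [hxy, star_add, star_mul']; simp
    have h2 : 2 * φ α = y * (2 * w - s) := by
      linear_combination hxy - h1 + hstar - y * hadd
    have : (4 * m : ℂ) = y ^ 2 * (4 * n - s ^ 2) := by
      linear_combination 4 * hφα - (2 * φ α + y * (2 * w - s)) * h2 - 4 * (y : ℂ) ^ 2 * hsq
    exact_mod_cast this
  by_contra! hle
  have hpos : 0 < 4 * n - s ^ 2 := by
    by_contra! h
    nlinarith [mul_nonneg (sq_nonneg y) (sub_nonneg.2 h)]
  have hsqfree : Squarefree (m : ℤ) := Int.squarefree_natCast.2 hm_sqfree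
  have hs4 : s ^ 2 % 4 = 0 ∨ s ^ 2 % 4 = 1 := by
    rcases Int.even_or_odd' s with ⟨k, rfl | rfl⟩
    · left; ring_nf; omega
    · right; ring_nf; omega
  have hcases : 4 * n - s ^ 2 = 3 ∨ 4 * n - s ^ 2 = 4 := by omega
  have hunit : ∀ z : ℤ, z * z ∣ (m : ℤ) → z * z = 1 := fun z hz => by
    rcases Int.isUnit_iff.1 (hsqfree z hz) with rfl | rfl <;> rfl
  rcases hcases with h | h <;> rw [h] at hdisc
  · have hy : Even y := by
      have : Even (y ^ 2) := by rw [Int.even_iff]; omega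
      exact (Int.even_pow.1 this).1
    obtain ⟨z, rfl⟩ := hy
    have hz : (m : ℤ) = z * z * 3 := by linarith
    have := hunit z ⟨3, hz⟩
    omega
  · have hz : (m : ℤ) = y * y := by linarith
    have := hunit y ⟨1, by rw [hz, mul_one]⟩
    omega

/-- For `m` squarefree positive, `m ≠ 1, 3`, `𝓞` the ring of integers of
`ℚ(√-m)`, and `ω ∈ 𝓞` with `𝓞 = ℤ[ω]`, the matrix `[[1,ω],[0,1]]` represents a non-trivial
element of the abelianization of the Bianchi group `SL₂(𝓞)`. -/
theorem unipotent_omega_nontrivial_in_abelianization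
    (m : ℕ) (hm_pos : 0 < m) (hm_sqfree : Squarefree m) (hm1 : m ≠ 1) (hm3 : m ≠ 3)
    (K : Type) [Field K] [NumberField K]
    (α : K) (hα : α ^ 2 = -(m : K)) (hgen : Algebra.adjoin ℚ {α} = ⊤)
    (ω : 𝓞 K) (hω : Algebra.adjoin ℤ ({ω} : Set (𝓞 K)) = ⊤) :
    Abelianization.of (G := Matrix.SpecialLinearGroup (Fin 2) (𝓞 K))
        ⟨!![1, ω; 0, 1], by norm_num [Matrix.det_fin_two_of]⟩ ≠ 1 := by
  have φ : K →+* ℂ := Classical.arbitrary (K →+* ℂ)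
  obtain ⟨s, n, hw, hlat⟩ := exists_isQuadraticInteger hm_pos hm_sqfree hm1 hm3 hα hgen hω φ
  exact Abelianization.of_unipotent_ne_one_of_embedding hw (φ.comp (algebraMap (𝓞 K) K)) hlat rfl
    _ rfl
end

section
/- Let m be a square-free positive integer with m ≠ 1 and m ≠ 3, let 𝓞 be the ring of integers of ℚ(√-m), and let ω ∈ 𝓞 be an element such that 𝓞 = ℤ[ω]. Then the image of the matrix [[1,ω],[0,1]] in the abelianization of the Bianchi group SL₂(𝓞) has infinite order. -/
open NumberField Matrix

/-- A function `f` on a `G`-set that each group element changes at only finitely many points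
determines a homomorphism `g ↦ ∑ x, (f (g • x) - f x)` to `ℤ`. An element with nonzero image
has infinite order in the abelianization. -/
theorem not_isOfFinOrder_abelianization_of_finsum_ne_zero {G Ω : Type*} [Group G] [MulAction G Ω]
    (f : Ω → ℤ) (hf : ∀ g : G, {x | f (g • x) ≠ f x}.Finite) {g : G}
    (hg : ∑ᶠ x, (f (g • x) - f x) ≠ 0) : ¬ IsOfFinOrder (Abelianization.of g) := by
  have hfin : ∀ g : G, (fun x => f (g • x) - f x).HasFiniteSupport := fun g =>
    (hf g).subset fun x hx => by simpa [sub_eq_zero] using hx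
  let φ : G →* Multiplicative ℤ := MonoidHom.mk'
    (fun g => Multiplicative.ofAdd (∑ᶠ x, (f (g • x) - f x))) fun g h => by
      rw [← ofAdd_add, ← finsum_comp_equiv (MulAction.toPerm h) (f := fun x => f (g • x) - f x),
        ← finsum_add_distrib _ (hfin h)]
      · simp [mul_smul]
      · exact (hfin g).preimage (MulAction.injective h).injOn
  intro h
  have h1 : IsOfFinOrder (φ g) := by
    simpa using (Abelianization.lift φ).isOfFinOrder h
  rw [isOfFinOrder_iff_eq_one] at h1
  exact hg (by simpa [φ] using h1)

namespace QuadraticAlgebra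

variable {a b : ℤ}

/-- The square root `2ω - b` of the discriminant `b² + 4a`. -/
def sqrtDisc (a b : ℤ) : QuadraticAlgebra ℤ a b := ⟨-b, 2⟩

theorem star_eq_add_sqrtDisc_mul (z : QuadraticAlgebra ℤ a b) :
    star z = z + sqrtDisc a b * (-z.im : ℤ) := by
  ext <;> simp [sqrtDisc]
  ring

theorem four_mul_norm (z : QuadraticAlgebra ℤ a b) :
    4 * z.norm = (2 * z.re + b * z.im) ^ 2 - (b ^ 2 + 4 * a) * z.im ^ 2 := by
  rw [norm_def]; ring

theorem norm_nonneg (hD : b ^ 2 + 4 * a < -4) (z : QuadraticAlgebra ℤ a b) : 0 ≤ z.norm := by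
  nlinarith [four_mul_norm z, sq_nonneg (2 * z.re + b * z.im), sq_nonneg z.im]

theorem norm_sqrtDisc : (sqrtDisc a b).norm = -(b ^ 2 + 4 * a) := by
  rw [norm_def, sqrtDisc]; ring

theorem eq_one_or_neg_one_of_norm_eq_one (hD : b ^ 2 + 4 * a < -4) {z : QuadraticAlgebra ℤ a b}
    (hz : z.norm = 1) : z = 1 ∨ z = -1 := by
  have h4 := four_mul_norm z
  have him : z.im = 0 := by
    by_contra h
    have : 0 < z.im ^ 2 := by positivity
    nlinarith [sq_nonneg (2 * z.re + b * z.im)]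
  have hre : z.re ^ 2 = 1 := by
    rw [him] at h4
    linarith
  rcases sq_eq_one_iff.mp hre with h | h
  · left; ext <;> simp [him, h]
  · right; ext <;> simp [him, h]

theorem eq_one_of_norm_eq_one (hD : b ^ 2 + 4 * a < -4) {ν : QuadraticAlgebra ℤ a b}
    (h : (1 + sqrtDisc a b * ν).norm = 1) : 1 + sqrtDisc a b * ν = 1 := by
  refine (eq_one_or_neg_one_of_norm_eq_one hD h).resolve_right fun h' => ?_
  have h2 : sqrtDisc a b * ν = -(2 : ℤ) := by push_cast; linear_combination h'
  have h3 := congrArg norm h2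
  rw [map_mul, norm_sqrtDisc, norm_neg, norm_intCast] at h3
  norm_num at h3
  have := norm_nonneg hD ν
  rcases this.eq_or_lt with h0 | h0
  · simp [← h0] at h3
  · nlinarith

/-- Skew-Hermitian matrices of determinant one congruent to `!![0, 1; -1, 0]` modulo the square
root of the discriminant; each describes an oriented totally geodesic plane in hyperbolic
3-space. -/
def PlaneForm (a b : ℤ) : Type :=
  {X : Matrix (Fin 2) (Fin 2) (QuadraticAlgebra ℤ a b) //
    Xᴴ = -X ∧ X.det = 1 ∧ ∃ Y, X = !![0, 1; -1, 0] + sqrtDisc a b • Y}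

theorem conjTranspose_eq_add_sqrtDisc_smul
    (g : Matrix (Fin 2) (Fin 2) (QuadraticAlgebra ℤ a b)) :
    ∃ Z, gᴴ = gᵀ + sqrtDisc a b • Z :=
  ⟨Matrix.of fun i j => ((-(g j i).im : ℤ) : QuadraticAlgebra ℤ a b), by
    ext1 i j
    simp only [conjTranspose_apply, Matrix.add_apply, transpose_apply, Matrix.smul_apply, of_apply,
      smul_eq_mul]
    exact star_eq_add_sqrtDisc_mul _⟩

theorem mul_mul_transpose_of_det_eq_one {R : Type*} [CommRing R] {g : Matrix (Fin 2) (Fin 2) R}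
    (hg : g.det = 1) : g * !![0, 1; -1, 0] * gᵀ = !![0, 1; -1, 0] := by
  rw [det_fin_two] at hg
  ext i j
  fin_cases i <;> fin_cases j <;> simp [mul_apply, Fin.sum_univ_two]
  · ring
  · linear_combination hg
  · linear_combination -hg
  · ring

instance : MulAction (SpecialLinearGroup (Fin 2) (QuadraticAlgebra ℤ a b)) (PlaneForm a b) where
  smul g X := ⟨g.1 * X.1 * g.1ᴴ, by
      simp [conjTranspose_mul, X.2.1, Matrix.mul_assoc], by
      simp [X.2.2.1], by
      obtain ⟨Y, hY⟩ := X.2.2.2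
      obtain ⟨Z, hZ⟩ := conjTranspose_eq_add_sqrtDisc_smul g.1
      refine ⟨g.1 * !![0, 1; -1, 0] * Z + g.1 * Y * g.1ᴴ, ?_⟩
      rw [hY, Matrix.mul_add, Matrix.add_mul, smul_add, ← add_assoc]
      conv_lhs => enter [1]; rw [hZ, Matrix.mul_add, mul_mul_transpose_of_det_eq_one g.2]
      simp⟩
  one_smul X := Subtype.ext <| by
    change (1 : Matrix _ _ _) * X.1 * (1 : Matrix _ _ _)ᴴ = X.1
    simp
  mul_smul g h X := Subtype.ext <| by
    change (g.1 * h.1) * X.1 * (g.1 * h.1)ᴴ = g.1 * (h.1 * X.1 * h.1ᴴ) * g.1ᴴ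
    simp [conjTranspose_mul, Matrix.mul_assoc]

namespace PlaneForm

theorem coe_smul (g : SpecialLinearGroup (Fin 2) (QuadraticAlgebra ℤ a b)) (X : PlaneForm a b) :
    (g • X).1 = g.1 * X.1 * g.1ᴴ := rfl

theorem exists_entries (hD : b ^ 2 + 4 * a < -4) (X : PlaneForm a b) :
    ∃ (A C : ℤ) (ν : QuadraticAlgebra ℤ a b),
      X.1 = !![sqrtDisc a b * A, 1 + sqrtDisc a b * ν;
        -star (1 + sqrtDisc a b * ν), sqrtDisc a b * C] ∧
      (1 + sqrtDisc a b * ν).norm = 1 - (b ^ 2 + 4 * a) * (A * C) := by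
  obtain ⟨X, hskew, hdet, Y, hY⟩ := X
  have real_of_skew : ∀ y : QuadraticAlgebra ℤ a b,
      star (sqrtDisc a b * y) = -(sqrtDisc a b * y) → y = (y.re : ℤ) := fun y hy => by
    have h := congrArg re hy
    simp [sqrtDisc] at h
    have : (b ^ 2 + 4 * a) * y.im = 0 := by linear_combination h
    have : y.im = 0 := by simpa [show b ^ 2 + 4 * a ≠ 0 by omega] using this
    ext <;> simp [this]
  have hsk : ∀ i j, star (X j i) = -X i j := fun i j => congrFun (congrFun hskew i) j
  have h00 := congrFun (congrFun hY 0) 0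
  have h01 := congrFun (congrFun hY 0) 1
  have h11 := congrFun (congrFun hY 1) 1
  simp at h00 h01 h11
  have hA := real_of_skew (Y 0 0) (by rw [← h00]; exact hsk 0 0)
  have hC := real_of_skew (Y 1 1) (by rw [← h11]; exact hsk 1 1)
  have hX : X = !![sqrtDisc a b * (Y 0 0).re, 1 + sqrtDisc a b * Y 0 1;
        -star (1 + sqrtDisc a b * Y 0 1), sqrtDisc a b * (Y 1 1).re] := by
    rw [eta_fin_two X, ← hA, ← hC, ← h00, ← h01, ← h11, hsk 1 0, neg_neg]
  refine ⟨(Y 0 0).re, (Y 1 1).re, Y 0 1, hX, ?_⟩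
  rw [hX, det_fin_two_of] at hdet
  have h := congrArg re hdet
  simp [sqrtDisc] at h
  simp [norm_def, sqrtDisc]
  linear_combination h

/-- Twice the trace of the integral Hermitian form attached to a plane; its sign tells on which
side of the plane the point `j` of hyperbolic 3-space lies. -/
def side (X : PlaneForm a b) : ℤ := (X.1 0 0 + X.1 1 1).im

theorem side_eq {X : PlaneForm a b} {A C : ℤ} {β : QuadraticAlgebra ℤ a b}
    (hX : X.1 = !![sqrtDisc a b * A, β; -star β, sqrtDisc a b * C]) :
    X.side = 2 * (A + C) := by
  simp [side, hX, sqrtDisc]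
  ring

theorem side_smul (g : SpecialLinearGroup (Fin 2) (QuadraticAlgebra ℤ a b)) {X : PlaneForm a b}
    {A C : ℤ} {β : QuadraticAlgebra ℤ a b}
    (hX : X.1 = !![sqrtDisc a b * A, β; -star β, sqrtDisc a b * C]) :
    (g • X).side = 2 * (((g.1 0 0).norm + (g.1 1 0).norm) * A
      + ((g.1 0 1).norm + (g.1 1 1).norm) * C
      + (β * (g.1 0 0 * star (g.1 0 1) + g.1 1 0 * star (g.1 1 1))).im) := by
  simp [side, coe_smul, hX, sqrtDisc, norm_def, mul_apply, Fin.sum_univ_two]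
  ring

theorem norm_gram_eq_one (g : SpecialLinearGroup (Fin 2) (QuadraticAlgebra ℤ a b)) :
    ((g.1 0 0).norm + (g.1 1 0).norm) * ((g.1 0 1).norm + (g.1 1 1).norm)
      - (g.1 0 0 * star (g.1 0 1) + g.1 1 0 * star (g.1 1 1)).norm = 1 := by
  have h := congrArg norm g.2
  rw [det_fin_two, norm_one] at h
  rw [← h]
  simp [norm_def]
  ring

theorem mul_nonneg_of_norm_eq (hD : b ^ 2 + 4 * a < -4) {A C : ℤ} {β : QuadraticAlgebra ℤ a b}
    (h : β.norm = 1 - (b ^ 2 + 4 * a) * (A * C)) : 0 ≤ A * C := by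
  have := norm_nonneg hD β
  by_contra! hAC
  nlinarith

/-- The form of the plane over the line `im z = n` in the upper half space model. -/
def vertical (n : ℤ) : PlaneForm a b :=
  ⟨!![sqrtDisc a b * n, 1; -1, 0], by
    ext1 i j
    fin_cases i <;> fin_cases j <;> ext <;> simp [sqrtDisc]
    exact Or.inl (by ring), by simp [det_fin_two_of], !![n, 0; 0, 0], by
    ext1 i j
    fin_cases i <;> fin_cases j <;> simp⟩

theorem side_vertical (n : ℤ) : (vertical n : PlaneForm a b).side = 2 * n := by
  rw [side_eq (A := n) (C := 0) (β := 1) (by simp [vertical]), add_zero]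

theorem vertical_injective : Function.Injective (vertical : ℤ → PlaneForm a b) := fun n k h => by
  have := congrArg side h
  rw [side_vertical, side_vertical] at this
  omega

/-- The translation by `ω`. -/
def translation (a b : ℤ) : SpecialLinearGroup (Fin 2) (QuadraticAlgebra ℤ a b) :=
  ⟨!![1, omega; 0, 1], by simp [det_fin_two_of]⟩

theorem side_translation_vertical (n : ℤ) :
    (translation a b • (vertical n : PlaneForm a b)).side = 2 * (n - 1) := by
  rw [side_smul _ (A := n) (C := 0) (β := 1) (by simp [vertical])]
  simp [translation]
  ring

theorem eq_vertical_or_sign_side_translation_eq (hD : b ^ 2 + 4 * a < -4) (X : PlaneForm a b) :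
    (∃ n, X = vertical n) ∨ (translation a b • X).side.sign = X.side.sign := by
  obtain ⟨A, C, ν, hX, hn⟩ := exists_entries hD X
  have hAC := mul_nonneg_of_norm_eq hD hn
  by_cases hC : C = 0
  · left
    subst hC
    have h1 := eq_one_of_norm_eq_one hD (by simpa using hn)
    exact ⟨A, Subtype.ext (by simp [hX, h1, vertical])⟩
  · right
    obtain ⟨A', C', ν', hX', hn'⟩ := exists_entries hD (translation a b • X)
    have hAC' := mul_nonneg_of_norm_eq hD hn'
    have hCC : C' = C := by
      have h : (translation a b • X).1 1 1 = X.1 1 1 := by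
        rw [coe_smul]
        simp only [mul_apply, Fin.sum_univ_two, conjTranspose_apply, translation]
        simp
      rw [hX', hX] at h
      simpa [sqrtDisc] using congrArg im h
    subst hCC
    rw [side_eq hX, side_eq hX']
    rcases lt_or_gt_of_ne hC with h | h
    · rw [Int.sign_eq_neg_one_of_neg, Int.sign_eq_neg_one_of_neg] <;> nlinarith
    · rw [Int.sign_eq_one_of_pos, Int.sign_eq_one_of_pos] <;> nlinarith

theorem finsum_translation (hD : b ^ 2 + 4 * a < -4) :
    ∑ᶠ X : PlaneForm a b, ((translation a b • X).side.sign - X.side.sign) = -2 := by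
  classical
  rw [finsum_eq_sum_of_support_subset (s := {vertical 0, vertical 1})]
  · rw [Finset.sum_pair (vertical_injective.ne zero_ne_one)]
    simp only [side_translation_vertical, side_vertical]
    rfl
  · intro X hX
    rw [Function.mem_support, sub_ne_zero] at hX
    obtain ⟨n, rfl⟩ := (eq_vertical_or_sign_side_translation_eq hD X).resolve_right hX
    rw [side_translation_vertical, side_vertical] at hX
    have : n = 0 ∨ n = 1 := by
      by_contra! h
      apply hX
      rcases lt_or_gt_of_ne h.1 with h' | h'
      · rw [Int.sign_eq_neg_one_of_neg, Int.sign_eq_neg_one_of_neg] <;> omega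
      · rw [Int.sign_eq_one_of_pos, Int.sign_eq_one_of_pos] <;> omega
    rcases this with rfl | rfl <;> simp

theorem sq_le_sq_of_sign_ne {p q A C w : ℤ} (hp : 0 < p) (hq : 0 < q) (hAC : 0 ≤ A * C)
    (h : (2 * (p * A + q * C + w)).sign ≠ (2 * (A + C)).sign) :
    (p * A + q * C) ^ 2 ≤ w ^ 2 := by
  by_contra! hlt
  have habs := sq_lt_sq.mp hlt
  rw [abs_lt] at habs
  apply h
  rcases mul_nonneg_iff.mp hAC with ⟨hA, hC⟩ | ⟨hA, hC⟩
  · have h0 : 0 ≤ p * A + q * C := by positivity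
    rw [abs_of_nonneg h0] at habs
    have : 0 < A + C := by
      by_contra! hle
      obtain ⟨rfl, rfl⟩ : A = 0 ∧ C = 0 := by omega
      simp at habs
      omega
    rw [Int.sign_eq_one_of_pos, Int.sign_eq_one_of_pos] <;> omega
  · have h0 : p * A + q * C ≤ 0 := by nlinarith
    rw [abs_of_nonpos h0] at habs
    have : A + C < 0 := by
      by_contra! hle
      obtain ⟨rfl, rfl⟩ : A = 0 ∧ C = 0 := by omega
      simp at habs
      omega
    rw [Int.sign_eq_neg_one_of_neg, Int.sign_eq_neg_one_of_neg] <;> omega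

theorem bounds_of_sq_le {p q k A C w D : ℤ} (hD : D < -4) (hp : 0 < p) (hq : 0 < q)
    (hk : 0 ≤ k) (hpq : p * q - k = 1) (hAC : 0 ≤ A * C) (hu : (p * A + q * C) ^ 2 ≤ w ^ 2)
    (hw : -D * w ^ 2 ≤ 4 * ((1 - D * (A * C)) * k)) :
    A * C ≤ k ∧ A ^ 2 ≤ 4 * k * (k + 2) ∧ C ^ 2 ≤ 4 * k * (k + 2) := by
  have hD1 : 1 ≤ -D := by omega
  have hkey : (p * A - q * C) ^ 2 + 4 * (A * C) ≤ 4 * k := by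
    have h1 : -D * ((p * A - q * C) ^ 2 + 4 * (A * C)) ≤ 4 * k := by
      have h2 : -D * (p * A + q * C) ^ 2 ≤ -D * w ^ 2 :=
        mul_le_mul_of_nonneg_left hu (by omega)
      have h3 : (p * A + q * C) ^ 2 = (p * A - q * C) ^ 2 + 4 * (1 + k) * (A * C) := by
        linear_combination 4 * A * C * hpq
      rw [h3] at h2
      linarith
    nlinarith [mul_nonneg (sub_nonneg.mpr hD1)
      (add_nonneg (sq_nonneg (p * A - q * C)) (mul_nonneg zero_le_four hAC))]
  have hle : A * C ≤ k := by nlinarith [sq_nonneg (p * A - q * C)]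
  have hsum : (p * A) ^ 2 + 2 * (1 + k) * (A * C) + (q * C) ^ 2 ≤ 4 * k * (k + 2) := by
    have h3 : (p * A) ^ 2 + 2 * (1 + k) * (A * C) + (q * C) ^ 2 =
        (p * A - q * C) ^ 2 + 4 * (1 + k) * (A * C) := by
      linear_combination 2 * A * C * hpq
    rw [h3]
    nlinarith [mul_le_mul_of_nonneg_left hle hk]
  have hcross : 0 ≤ 2 * (1 + k) * (A * C) := by positivity
  have hA : A ^ 2 ≤ (p * A) ^ 2 := by
    rw [mul_pow]
    exact le_mul_of_one_le_left (sq_nonneg A) (one_le_pow₀ hp)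
  have hC : C ^ 2 ≤ (q * C) ^ 2 := by
    rw [mul_pow]
    exact le_mul_of_one_le_left (sq_nonneg C) (one_le_pow₀ hq)
  exact ⟨hle, by linarith [sq_nonneg (q * C)], by linarith [sq_nonneg (p * A)]⟩

theorem mem_Icc_of_sq_le {x M N : ℤ} (h : x ^ 2 ≤ M) (hMN : M ≤ N) : x ∈ Set.Icc (-N) N :=
  ⟨by linarith [Int.le_self_sq (-x), neg_sq x], by linarith [Int.le_self_sq x]⟩

theorem finite_norm_le (hD : b ^ 2 + 4 * a < -4) (B : ℤ) :
    {z : QuadraticAlgebra ℤ a b | z.norm ≤ B}.Finite := by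
  refine (((Set.finite_Icc (-(4 * B + |b| * (4 * B))) (4 * B + |b| * (4 * B))).prod
    (Set.finite_Icc (-(4 * B)) (4 * B))).preimage (equivProd a b).injective.injOn).subset ?_
  intro z hz
  have h4 := four_mul_norm z
  have hz' : z.norm ≤ B := hz
  have him := mem_Icc_of_sq_le (x := z.im) (M := 4 * B) (N := 4 * B)
    (by nlinarith [sq_nonneg (2 * z.re + b * z.im), sq_nonneg z.im]) le_rfl
  have hre := mem_Icc_of_sq_le (x := 2 * z.re + b * z.im) (M := 4 * B) (N := 4 * B)
    (by nlinarith [sq_nonneg z.im]) le_rfl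
  have hb : |b * z.im| ≤ |b| * (4 * B) := by
    rw [abs_mul]
    exact mul_le_mul_of_nonneg_left (abs_le.mpr him) (abs_nonneg b)
  rw [abs_le] at hb
  refine ⟨?_, him⟩
  obtain ⟨h1, h2⟩ := hre
  obtain ⟨h3, h4⟩ := hb
  change -_ ≤ z.re ∧ z.re ≤ _
  constructor <;> omega

theorem finite_sign_side_smul_ne (hD : b ^ 2 + 4 * a < -4)
    (g : SpecialLinearGroup (Fin 2) (QuadraticAlgebra ℤ a b)) :
    {X : PlaneForm a b | (g • X).side.sign ≠ X.side.sign}.Finite := by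
  set p := (g.1 0 0).norm + (g.1 1 0).norm
  set q := (g.1 0 1).norm + (g.1 1 1).norm
  set κ := g.1 0 0 * star (g.1 0 1) + g.1 1 0 * star (g.1 1 1)
  have hpq : p * q - κ.norm = 1 := norm_gram_eq_one g
  have hk := norm_nonneg hD κ
  have hp0 : 0 ≤ p := add_nonneg (norm_nonneg hD _) (norm_nonneg hD _)
  have hq0 : 0 ≤ q := add_nonneg (norm_nonneg hD _) (norm_nonneg hD _)
  have hp : 0 < p := hp0.lt_of_ne (by rintro h; rw [← h] at hpq; linarith)
  have hq : 0 < q := hq0.lt_of_ne (by rintro h; rw [← h] at hpq; linarith)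
  set M := 4 * κ.norm * (κ.norm + 2)
  refine (((Set.finite_Icc (-M) M).prod ((Set.finite_Icc (-M) M).prod
    (finite_norm_le hD (1 - (b ^ 2 + 4 * a) * κ.norm)))).image
      (fun t : ℤ × ℤ × QuadraticAlgebra ℤ a b =>
        !![sqrtDisc a b * t.1, t.2.2; -star t.2.2, sqrtDisc a b * t.2.1])).preimage
      Subtype.val_injective.injOn |>.subset ?_
  intro (X : PlaneForm a b) (hX : (g • X).side.sign ≠ X.side.sign)
  obtain ⟨A, C, ν, hX', hn⟩ := exists_entries hD X
  have hAC := mul_nonneg_of_norm_eq hD hn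
  rw [side_eq hX', side_smul g hX'] at hX
  have hw : -(b ^ 2 + 4 * a) * ((1 + sqrtDisc a b * ν) * κ).im ^ 2 ≤
      4 * ((1 - (b ^ 2 + 4 * a) * (A * C)) * κ.norm) := by
    rw [← hn, ← map_mul, four_mul_norm]
    nlinarith [sq_nonneg (2 * ((1 + sqrtDisc a b * ν) * κ).re
      + b * ((1 + sqrtDisc a b * ν) * κ).im)]
  obtain ⟨hle, hA, hC⟩ := bounds_of_sq_le hD hp hq hk hpq hAC
    (sq_le_sq_of_sign_ne hp hq hAC hX) hw
  refine ⟨(A, C, 1 + sqrtDisc a b * ν), ⟨mem_Icc_of_sq_le hA le_rfl, mem_Icc_of_sq_le hC le_rfl,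
    ?_⟩, hX'.symm⟩
  change (1 + sqrtDisc a b * ν).norm ≤ _
  rw [hn]
  nlinarith

end PlaneForm

theorem not_isOfFinOrder_abelianization_translation (hD : b ^ 2 + 4 * a < -4) :
    ¬ IsOfFinOrder (Abelianization.of (PlaneForm.translation a b)) :=
  not_isOfFinOrder_abelianization_of_finsum_ne_zero (fun X : PlaneForm a b => X.side.sign)
    (PlaneForm.finite_sign_side_smul_ne hD) (by rw [PlaneForm.finsum_translation hD]; decide)

end QuadraticAlgebra

/-- A monic quadratic relation for an element of a ring of integers of degree at most two. -/
theorem exists_mul_self_eq_of_finrank_le_two {K : Type*} [Field K] [NumberField K]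
    (hK : Module.finrank ℚ K ≤ 2) (ω : 𝓞 K) : ∃ a b : ℤ, ω * ω = a • 1 + b • ω := by
  have hint := RingOfIntegers.isIntegral ω
  have hdeg : (minpoly ℤ ω).natDegree ≤ 2 := by
    have h := minpoly.isIntegrallyClosed_eq_field_fractions ℚ K hint
    rw [← (minpoly.monic hint).natDegree_map (algebraMap ℤ ℚ), ← h]
    exact (minpoly.natDegree_le _).trans hK
  set P := minpoly ℤ ω * Polynomial.X ^ (2 - (minpoly ℤ ω).natDegree)
  have hmonic : P.Monic := (minpoly.monic hint).mul (Polynomial.monic_X_pow _)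
  have hP : P.natDegree = 2 := by
    rw [(minpoly.monic hint).natDegree_mul (Polynomial.monic_X_pow _),
      Polynomial.natDegree_X_pow]
    omega
  have h0 : Polynomial.aeval ω P = 0 := by simp [P]
  rw [Polynomial.aeval_eq_sum_range, hP] at h0
  have h2 : P.coeff 2 = 1 := by rw [← hP]; exact hmonic
  simp only [Finset.sum_range_succ, Finset.sum_range_zero, h2, pow_zero, pow_one] at h0
  refine ⟨-P.coeff 0, -P.coeff 1, ?_⟩
  simp only [zsmul_eq_mul] at h0 ⊢
  push_cast
  linear_combination h0

theorem finrank_le_two_of_sq_eq {K : Type*} [Field K] [NumberField K] {α : K} {c : ℚ}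
    (hα : α ^ 2 = algebraMap ℚ K c) (hgen : Algebra.adjoin ℚ {α} = ⊤) :
    Module.finrank ℚ K ≤ 2 := by
  have hint : IsIntegral ℚ α := .of_finite ℚ α
  rw [(PowerBasis.ofAdjoinEqTop hint hgen).finrank, ← PowerBasis.natDegree_minpoly,
    PowerBasis.ofAdjoinEqTop_gen]
  refine (Polynomial.natDegree_le_of_dvd (minpoly.dvd ℚ α (p := .X ^ 2 - .C c) (by simp [hα]))
    (Polynomial.X_pow_sub_C_ne_zero two_pos c)).trans ?_
  rw [Polynomial.natDegree_X_pow_sub_C]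

/-- If `√-m` lies in an order of discriminant `b² + 4a`, where `m ≠ 1, 3` is squarefree, then this
discriminant is less than `-4`. -/
theorem discriminant_lt_neg_four {R : Type*} [CommRing R] [IsDomain R] [CharZero R] {m : ℕ}
    (hm_pos : 0 < m) (hm_sqfree : Squarefree m) (hm1 : m ≠ 1) (hm3 : m ≠ 3) {a b : ℤ} {ω α : R}
    (hω : ω * ω = a • 1 + b • ω) (hα : α ^ 2 = -(m : R)) {x y : ℤ} (hxy : α = x • 1 + y • ω) :
    b ^ 2 + 4 * a < -4 := by
  simp only [zsmul_eq_mul, mul_one] at hω hxy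
  have hrel : ((4 * (2 * x + b * y) : ℤ) : R) * α =
      (((2 * x + b * y) ^ 2 - 4 * m - y ^ 2 * (b ^ 2 + 4 * a) : ℤ) : R) := by
    push_cast
    linear_combination 4 * hα - 2 * (2 * α - (2 * x + b * y) + y * (2 * ω - b)) * hxy
      - 4 * y ^ 2 * hω
  have hsq : (4 * (2 * x + b * y)) ^ 2 * (-(m : ℤ)) =
      ((2 * x + b * y) ^ 2 - 4 * m - y ^ 2 * (b ^ 2 + 4 * a)) ^ 2 := by
    have h : (((4 * (2 * x + b * y)) ^ 2 * (-(m : ℤ)) : ℤ) : R) =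
        ((((2 * x + b * y) ^ 2 - 4 * m - y ^ 2 * (b ^ 2 + 4 * a)) ^ 2 : ℤ) : R) := by
      push_cast at hrel ⊢
      linear_combination (4 * (2 * x + b * y) * α + ((2 * x + b * y) ^ 2 - 4 * m
        - y ^ 2 * (b ^ 2 + 4 * a))) * hrel - (4 * (2 * x + b * y)) ^ 2 * hα
    exact_mod_cast h
  have hm : (0 : ℤ) < m := by exact_mod_cast hm_pos
  have ht : 2 * x + b * y = 0 := by
    by_contra h
    have : 0 < (4 * (2 * x + b * y)) ^ 2 := by positivity
    nlinarith [sq_nonneg ((2 * x + b * y) ^ 2 - 4 * m - y ^ 2 * (b ^ 2 + 4 * a))]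
  have hD : y ^ 2 * (b ^ 2 + 4 * a) = -4 * m := by
    rw [ht] at hsq
    have := pow_eq_zero_iff two_ne_zero |>.mp (hsq.symm.trans (by ring))
    linarith
  have hmsq : Squarefree (m : ℤ) := Int.squarefree_natCast.mpr hm_sqfree
  have hunit : ∀ z : ℤ, z * z ∣ m → z ^ 2 = 1 := fun z hz =>
    sq_eq_one_iff.mpr (Int.isUnit_iff.mp (hmsq z hz))
  have hneg : b ^ 2 + 4 * a < 0 := by
    by_contra! h
    nlinarith [sq_nonneg y, mul_nonneg (sq_nonneg y) h]
  have hne4 : b ^ 2 + 4 * a ≠ -4 := fun h => by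
    rw [h] at hD
    have := hunit y ⟨1, by linarith⟩
    omega
  have hne3 : b ^ 2 + 4 * a ≠ -3 := fun h => by
    rw [h] at hD
    obtain ⟨z, rfl⟩ : (2 : ℤ) ∣ y := Int.prime_two.dvd_of_dvd_pow (n := 2) (by omega)
    have := hunit z ⟨3, by linarith⟩
    have : (m : ℤ) = 3 := by linarith
    omega
  rcases Int.even_or_odd' b with ⟨c, rfl | rfl⟩ <;> ring_nf at hneg hne4 hne3 ⊢ <;> omega


theorem QuadraticAlgebra.lift_surjective {R : Type*} [CommRing R] {a b : ℤ} {ω : R}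
    (hω : ω * ω = a • 1 + b • ω) (htop : Algebra.adjoin ℤ {ω} = ⊤) :
    Function.Surjective (QuadraticAlgebra.lift ⟨ω, hω⟩) := by
  rw [← AlgHom.range_eq_top, eq_top_iff, ← htop, Algebra.adjoin_le_iff, Set.singleton_subset_iff]
  exact ⟨QuadraticAlgebra.omega, by simp⟩

theorem QuadraticAlgebra.lift_injective {R : Type*} [CommRing R] [CharZero R] {a b : ℤ}
    (hD : b ^ 2 + 4 * a < -4) {ω : R} (hω : ω * ω = a • 1 + b • ω) :
    Function.Injective (QuadraticAlgebra.lift ⟨ω, hω⟩) := by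
  rw [injective_iff_map_eq_zero]
  intro z hz
  have h := congrArg (QuadraticAlgebra.lift ⟨ω, hω⟩) (algebraMap_norm_eq_mul_star z)
  rw [map_mul, hz, zero_mul, AlgHom.commutes, eq_intCast, Int.cast_eq_zero] at h
  have h4 := four_mul_norm z
  have him : z.im = 0 := by
    by_contra h
    have : 0 < z.im ^ 2 := by positivity
    nlinarith [sq_nonneg (2 * z.re + b * z.im)]
  have hre : z.re ^ 2 = 0 := by
    rw [him] at h4
    linarith
  ext
  · simpa using hre
  · exact him

/-- For `m` squarefree positive, `m ≠ 1, 3`, `𝓞` the ring of integers of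
`ℚ(√-m)`, and `ω ∈ 𝓞` with `𝓞 = ℤ[ω]`, the image of the matrix `[[1,ω],[0,1]]` in the
abelianization of the Bianchi group `SL₂(𝓞)` has infinite order. -/
theorem unipotent_omega_infinite_order_in_abelianization
    (m : ℕ) (hm_pos : 0 < m) (hm_sqfree : Squarefree m) (hm1 : m ≠ 1) (hm3 : m ≠ 3)
    (K : Type) [Field K] [NumberField K]
    (α : K) (hα : α ^ 2 = -(m : K)) (hgen : Algebra.adjoin ℚ {α} = ⊤)
    (ω : 𝓞 K) (hω : Algebra.adjoin ℤ ({ω} : Set (𝓞 K)) = ⊤) :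
    ¬ IsOfFinOrder
        (Abelianization.of (G := Matrix.SpecialLinearGroup (Fin 2) (𝓞 K))
          ⟨!![1, ω; 0, 1], by norm_num [Matrix.det_fin_two_of]⟩) := by
  have hα' : IsIntegral ℤ α := .of_pow two_pos (by
    simpa [hα] using isIntegral_algebraMap (R := ℤ) (A := K) (x := -m))
  obtain ⟨a, b, hab⟩ := exists_mul_self_eq_of_finrank_le_two
    (finrank_le_two_of_sq_eq (c := -m) (by simpa using hα) hgen) ω
  have hsurj := QuadraticAlgebra.lift_surjective hab hω
  obtain ⟨z, hz⟩ := hsurj ⟨α, hα'⟩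
  have hD := discriminant_lt_neg_four (R := 𝓞 K) hm_pos hm_sqfree hm1 hm3 hab
    (α := ⟨α, hα'⟩) (RingOfIntegers.ext (by push_cast; exact hα)) hz.symm
  let e := RingEquiv.ofBijective _ ⟨QuadraticAlgebra.lift_injective hD hab, hsurj⟩
  have he : e.symm ω = QuadraticAlgebra.omega := by
    rw [RingEquiv.symm_apply_eq]
    change ω = QuadraticAlgebra.lift ⟨ω, hab⟩ QuadraticAlgebra.omega
    simp
  let T : SpecialLinearGroup (Fin 2) (𝓞 K) := ⟨!![1, ω; 0, 1], by simp⟩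
  have hT : SpecialLinearGroup.map e.symm.toRingHom T =
      QuadraticAlgebra.PlaneForm.translation a b := by
    ext1 i j
    rw [SpecialLinearGroup.map_apply_coe, RingHom.mapMatrix_apply, Matrix.map_apply]
    fin_cases i <;> fin_cases j <;> simp [T, QuadraticAlgebra.PlaneForm.translation, he]
  intro h
  have h' := (Abelianization.map (SpecialLinearGroup.map e.symm.toRingHom)).isOfFinOrder
    (x := Abelianization.of T) h
  rw [Abelianization.map_of, hT] at h'
  exact QuadraticAlgebra.not_isOfFinOrder_abelianization_translation hD h'
end

section
/- Let m be a square-free positive integer with m ≠ 1 and m ≠ 3, and let 𝓞 be the ring of integers of ℚ(√-m). For every t ∈ 𝓞, the image of the matrix [[1,t],[0,1]] in the abelianization of the Bianchi group SL₂(𝓞) has finite order if and only if t lies in ℤ (i.e. t is in the image of the canonical map ℤ → 𝓞). -/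
open NumberField Matrix

section Displacement

variable {G X : Type*} [Group G] [MulAction G X]

/-- The total displacement of an integer-valued function on a `G`-set which every element of `G`
changes at only finitely many points, as a homomorphism to `ℤ`. -/
noncomputable def displacementHom (σ : X → ℤ)
    (hσ : ∀ g : G, (Function.support fun x => σ (g • x) - σ x).Finite) :
    G →* Multiplicative ℤ :=
  MonoidHom.mk' (fun g => Multiplicative.ofAdd (∑ᶠ x, (σ (g • x) - σ x))) fun g h => by
    rw [← ofAdd_add]
    congr 1
    have hcomp : (fun x => σ (g • h • x) - σ (h • x)) =
        (fun x => σ (g • x) - σ x) ∘ MulAction.toPerm h := rfl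
    have hfin : (Function.support fun x => σ (g • h • x) - σ (h • x)).Finite := by
      rw [hcomp, Function.support_comp_eq_preimage]
      exact (hσ g).preimage (MulAction.toPerm h).injective.injOn
    rw [← finsum_comp_equiv (MulAction.toPerm h) (f := fun x => σ (g • x) - σ x)]
    simp only [MulAction.toPerm_apply]
    rw [← finsum_add_distrib hfin (hσ h)]
    refine finsum_congr fun x => ?_
    simp [mul_smul]

end Displacement

section TwistedClass

variable {G : Type*} [Group G]

/-- The twisted conjugacy class of the identity under `g • x = g * x * (θ g)⁻¹`. -/
def TwistedClass (θ : G →* G) : Type _ := Set.range fun g => g * (θ g)⁻¹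

instance (θ : G →* G) : MulAction G (TwistedClass θ) where
  smul g x := ⟨g * x.1 * (θ g)⁻¹, by
    obtain ⟨_, h, rfl⟩ := x
    exact ⟨g * h, by simp [mul_assoc]⟩⟩
  one_smul x := Subtype.ext (by change 1 * x.1 * (θ 1)⁻¹ = x.1; simp)
  mul_smul g h x := Subtype.ext (by
    change g * h * x.1 * (θ (g * h))⁻¹ = g * (h * x.1 * (θ h)⁻¹) * (θ g)⁻¹
    simp [mul_assoc])

lemma TwistedClass.val_smul {θ : G →* G} (g : G) (x : TwistedClass θ) :
    (g • x).1 = g * x.1 * (θ g)⁻¹ := rfl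

end TwistedClass

lemma crossing_bound {X Y w₁ w₂ p₁ p₂ q r : ℝ} (hX : 0 < X) (hY : 0 < Y)
    (hdet : X * Y - (w₁ ^ 2 + w₂ ^ 2) = 4) (hN : p₁ ^ 2 + p₂ ^ 2 + q * r = 1)
    (h : 0 ≤ r * (q * X - r * Y - 2 * (p₂ * w₁ - p₁ * w₂))) :
    4 * (p₁ ^ 2 + p₂ ^ 2) ≤ X * Y ∧ 4 * r ^ 2 ≤ X ^ 2 := by
  have h' : X * (p₁ ^ 2 + p₂ ^ 2) + Y * r ^ 2 + 2 * r * (p₂ * w₁ - p₁ * w₂) ≤ X := by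
    linear_combination h + X * hN
  constructor
  · have := mul_le_mul_of_nonneg_left h' hY.le
    linear_combination this + sq_nonneg (Y * r + (p₂ * w₁ - p₁ * w₂)) +
      sq_nonneg (p₁ * w₁ + p₂ * w₂) - (p₁ ^ 2 + p₂ ^ 2) * hdet
  · have := mul_le_mul_of_nonneg_left h' hX.le
    linear_combination this + sq_nonneg (X * p₁ - r * w₂) +
      sq_nonneg (X * p₂ + r * w₁) - r ^ 2 * hdet

/-- The embedding `ι : R → ℂ` and the endomorphism `c` of `R` behave like a complex embedding of
an imaginary quadratic ring of integers together with complex conjugation. -/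
structure IsImaginaryQuadratic {R : Type*} [CommRing R] (ι : R →+* ℂ) (c : R →+* R) : Prop where
  injective : Function.Injective ι
  map_conj : ∀ x, ι (c x) = starRingEnd ℂ (ι x)
  exists_int : ∀ x, c x = x → ∃ n : ℤ, (n : R) = x
  finite : ∀ B : ℝ, {x : R | ‖ι x‖ ≤ B}.Finite

namespace IsImaginaryQuadratic

variable {R : Type*} [CommRing R] {ι : R →+* ℂ} {c : R →+* R}

lemma conj_conj (H : IsImaginaryQuadratic ι c) (x : R) : c (c x) = x :=
  H.injective (by simp [H.map_conj])

lemma eq_zero_of_norm_lt_one (H : IsImaginaryQuadratic ι c) {x : R} (hx : ‖ι x‖ < 1) :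
    x = 0 := by
  obtain ⟨n, hn⟩ := H.exists_int (x * c x) (by rw [map_mul, H.conj_conj, mul_comm])
  have h : ((n : ℝ) : ℂ) = ((‖ι x‖ ^ 2 : ℝ) : ℂ) := by
    have := congrArg ι hn
    rw [map_mul, H.map_conj, Complex.mul_conj, Complex.normSq_eq_norm_sq] at this
    simpa using this
  have h' : (n : ℝ) = ‖ι x‖ ^ 2 := Complex.ofReal_injective h
  have h1 : (n : ℝ) < 1 := by
    rw [h']
    exact pow_lt_one₀ (norm_nonneg _) hx two_ne_zero
  have h0 : (0 : ℝ) ≤ n := h' ▸ sq_nonneg _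
  have hn0 : n = 0 :=
    le_antisymm (Int.lt_add_one_iff.1 (by exact_mod_cast h1)) (by exact_mod_cast h0)
  rw [hn0, Int.cast_zero, eq_comm, sq_eq_zero_iff, norm_eq_zero] at h'
  exact H.injective (by rw [h', map_zero])

lemma mem_range_of_im_eq_zero (H : IsImaginaryQuadratic ι c) {x : R} (hx : (ι x).im = 0) :
    ∃ n : ℤ, (n : R) = x :=
  H.exists_int x (H.injective (by rw [H.map_conj, Complex.conj_eq_iff_im.2 hx]))

variable [CharZero R] {m : ℕ} {ω : R}

lemma eq_one_or_neg_one [IsDomain R] (H : IsImaginaryQuadratic ι c) (hm_pos : 0 < m)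
    (hm : Squarefree m) (hm1 : m ≠ 1) (hm3 : m ≠ 3) (hω : ω ^ 2 = -(m : R)) (hcω : c ω = -ω)
    {u : R}
    (hu : u * c u = 1) : u = 1 ∨ u = -1 := by
  obtain ⟨T, hT⟩ := H.exists_int (u + c u) (by rw [map_add, H.conj_conj, add_comm])
  obtain ⟨n, hn⟩ := H.exists_int (ω * (u - c u)) (by
    rw [map_mul, map_sub, H.conj_conj, hcω]; ring)
  have hTn : T ^ 2 * m + n ^ 2 = 4 * (m : ℤ) := by
    have : ((T ^ 2 * m + n ^ 2 : ℤ) : R) = ((4 * (m : ℤ) : ℤ) : R) := by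
      push_cast
      rw [hT, hn]
      linear_combination (u - c u) ^ 2 * hω + 4 * (m : R) * hu
    exact_mod_cast this
  have hdvd : (m : ℤ) ∣ n ^ 2 := ⟨4 - T ^ 2, by linear_combination hTn⟩
  obtain ⟨k, rfl⟩ := (Int.squarefree_natCast.2 hm).isRadical 2 n hdvd
  have hm0 : (m : ℤ) ≠ 0 := by exact_mod_cast hm_pos.ne'
  have hTk : T ^ 2 + m * k ^ 2 = 4 := mul_left_cancel₀ hm0 (by linear_combination hTn)
  have hm4 : m ≠ 4 := by
    rintro rfl
    exact absurd (Nat.isUnit_iff.1 (hm 2 (by norm_num))) (by norm_num)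
  have hk : k = 0 := by
    by_contra hk
    have hk1 : 0 < k ^ 2 := sq_pos_of_ne_zero hk
    have hk2 : k ^ 2 ≠ 2 := by
      intro h
      have hlt : k < 2 := by nlinarith
      have hgt : -2 < k := by nlinarith
      interval_cases k <;> omega
    generalize k ^ 2 = j at hTk hk1 hk2
    have hm_le : (m : ℤ) ≤ 4 := by nlinarith [sq_nonneg T]
    have hm2 : m = 2 := by omega
    subst hm2
    push_cast at hTk
    have hj : j ≤ 2 := by nlinarith [sq_nonneg T]
    have hTlt : T < 2 := by nlinarith
    have hTgt : -2 < T := by nlinarith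
    interval_cases T <;> omega
  subst hk
  have hω0 : ω ≠ 0 := by
    rintro rfl
    have : (m : R) = 0 := by linear_combination hω
    exact hm_pos.ne' (by exact_mod_cast this)
  have huc : u - c u = 0 := by
    have : ω * (u - c u) = 0 := by rw [← hn]; simp
    exact (mul_eq_zero.1 this).resolve_left hω0
  have : (u - 1) * (u + 1) = 0 := by linear_combination hu + u * huc
  rcases mul_eq_zero.1 this with h | h
  · exact Or.inl (by linear_combination h)
  · exact Or.inr (by linear_combination h)

lemma dvd_of_conj_eq_neg [IsDomain R] (H : IsImaginaryQuadratic ι c) (hm_pos : 0 < m)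
    (hm : Squarefree m)
    (hω : ω ^ 2 = -(m : R)) (hcω : c ω = -ω) {x : R} (hx : c x = -x) : ω ∣ x := by
  obtain ⟨k, hk⟩ := H.exists_int (ω * x) (by rw [map_mul, hcω, hx, neg_mul_neg])
  obtain ⟨j, hj⟩ := H.exists_int (-x ^ 2) (by rw [map_neg, map_pow, hx, neg_sq])
  have hkj : k ^ 2 = (m : ℤ) * j := by
    have : ((k ^ 2 : ℤ) : R) = ((m * j : ℤ) : R) := by
      push_cast
      rw [hk, hj]
      linear_combination x ^ 2 * hω
    exact_mod_cast this
  obtain ⟨l, rfl⟩ := (Int.squarefree_natCast.2 hm).isRadical 2 k ⟨j, hkj⟩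
  have hm0 : (m : R) ≠ 0 := by exact_mod_cast hm_pos.ne'
  push_cast at hk
  exact ⟨-l, mul_left_cancel₀ hm0 (by linear_combination ω * hk + x * hω)⟩

lemma not_isUnit_of_sq_eq_neg (H : IsImaginaryQuadratic ι c) (hm1 : m ≠ 1)
    (hω : ω ^ 2 = -(m : R)) (hcω : c ω = -ω) : ¬ IsUnit ω := by
  intro hu
  obtain ⟨e, he⟩ := hu.exists_right_inv
  obtain ⟨n, hn⟩ := H.exists_int (e * c e) (by rw [map_mul, H.conj_conj, mul_comm])
  have hce : -ω * c e = 1 := by rw [← hcω, ← map_mul, he, map_one]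
  have : ((m * n : ℤ) : R) = ((1 : ℤ) : R) := by
    push_cast
    rw [hn]
    linear_combination e * c e * hω + (-ω * c e) * he + hce
  have hmn : (m : ℤ) * n = 1 := by exact_mod_cast this
  exact hm1 (by simpa using Int.isUnit_iff_natAbs_eq.1 (IsUnit.of_mul_eq_one _ hmn))

/-- An element of the twisted class of the identity which is upper triangular is unipotent. -/
lemma mul_conj_sub_eq_one [IsDomain R] (H : IsImaginaryQuadratic ι c) (hm_pos : 0 < m)
    (hm : Squarefree m) (hm1 : m ≠ 1) (hm3 : m ≠ 3) (hω : ω ^ 2 = -(m : R)) (hcω : c ω = -ω)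
    {x y z w : R}
    (hdet : x * w - y * z = 1) (h : z * c w = w * c z) : x * c w - y * c z = 1 := by
  have hw : c w = w * (x * c w - y * c z) := by linear_combination (-c w) * hdet - y * h
  have hz : c z = z * (x * c w - y * c z) := by linear_combination (-c z) * hdet - x * h
  have hu : (x * c w - y * c z) * c (x * c w - y * c z) = 1 := by
    have hdet' : c x * c w - c y * c z = 1 := by
      rw [← map_mul, ← map_mul, ← map_sub, hdet, map_one]
    simp only [map_sub, map_mul, H.conj_conj]
    linear_combination hdet' - c x * hw + c y * hz
  rcases H.eq_one_or_neg_one hm_pos hm hm1 hm3 hω hcω hu with h1 | h1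
  · exact h1
  · rw [h1] at hw hz
    obtain ⟨w', hw'⟩ := H.dvd_of_conj_eq_neg hm_pos hm hω hcω (hw.trans (mul_neg_one w))
    obtain ⟨z', hz'⟩ := H.dvd_of_conj_eq_neg hm_pos hm hω hcω (hz.trans (mul_neg_one z))
    refine absurd (IsUnit.of_mul_eq_one (x * w' - y * z') ?_) (H.not_isUnit_of_sq_eq_neg hm1 hω hcω)
    rw [← hdet, hw', hz']
    ring

end IsImaginaryQuadratic

section Entries

variable {R S : Type*} [CommRing R] [CommRing S]

lemma sl_two_mul_apply (g h : SpecialLinearGroup (Fin 2) R) (i j : Fin 2) :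
    (g * h) i j = g i 0 * h 0 j + g i 1 * h 1 j := by
  change (g.1 * h.1) i j = _
  rw [mul_apply, Fin.sum_univ_two]

lemma sl_two_inv_apply (g : SpecialLinearGroup (Fin 2) R) :
    g⁻¹ 0 0 = g 1 1 ∧ g⁻¹ 0 1 = -g 0 1 ∧ g⁻¹ 1 0 = -g 1 0 ∧ g⁻¹ 1 1 = g 0 0 := by
  refine ⟨?_, ?_, ?_, ?_⟩
  · change adjugate g.1 0 0 = _
    rw [adjugate_fin_two]; rfl
  · change adjugate g.1 0 1 = _
    rw [adjugate_fin_two]; rfl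
  · change adjugate g.1 1 0 = _
    rw [adjugate_fin_two]; rfl
  · change adjugate g.1 1 1 = _
    rw [adjugate_fin_two]; rfl

lemma sl_two_map_apply (c : R →+* S) (g : SpecialLinearGroup (Fin 2) R) (i j : Fin 2) :
    SpecialLinearGroup.map c g i j = c (g i j) := rfl

lemma sl_two_det (g : SpecialLinearGroup (Fin 2) R) : g 0 0 * g 1 1 - g 0 1 * g 1 0 = 1 :=
  (det_fin_two g.1).symm.trans g.2

end Entries

section Side

variable {R : Type*} [CommRing R] {ι : R →+* ℂ} {c : R →+* R}

/-- The twisted class of the identity in `SL₂(R)`. Its elements correspond to the translates of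
an oriented hyperbolic plane in hyperbolic 3-space, whose stabilizer consists of the matrices
fixed by `c`. -/
abbrev RealPlane (c : R →+* R) : Type _ :=
  TwistedClass (SpecialLinearGroup.map (n := Fin 2) c)

namespace RealPlane

/-- The matrix attached to a plane. -/
def mat (N : RealPlane c) : SpecialLinearGroup (Fin 2) R := N.1

lemma mat_smul (g : SpecialLinearGroup (Fin 2) R) (N : RealPlane c) :
    (g • N).mat = g * N.mat * (SpecialLinearGroup.map c g)⁻¹ := rfl

lemma mat_injective : Function.Injective (mat (c := c)) := Subtype.val_injective

lemma exists_mat_entries (N : RealPlane c) : ∃ x y z w : R, x * w - y * z = 1 ∧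
    N.mat 0 0 = x * c w - y * c z ∧ N.mat 0 1 = y * c x - x * c y ∧
    N.mat 1 0 = z * c w - w * c z ∧ N.mat 1 1 = w * c x - z * c y := by
  obtain ⟨_, g, rfl⟩ := N
  refine ⟨g 0 0, g 0 1, g 1 0, g 1 1, sl_two_det g, ?_⟩
  obtain ⟨h00, h01, h10, h11⟩ := sl_two_inv_apply (SpecialLinearGroup.map c g)
  simp only [sl_two_map_apply] at h00 h01 h10 h11
  simp only [mat, sl_two_mul_apply, h00, h01, h10, h11]
  refine ⟨?_, ?_, ?_, ?_⟩ <;> ring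

lemma mat_one_one (H : IsImaginaryQuadratic ι c) (N : RealPlane c) :
    N.mat 1 1 = c (N.mat 0 0) := by
  obtain ⟨x, y, z, w, -, h00, -, -, h11⟩ := N.exists_mat_entries
  rw [h00, h11]
  simp only [map_sub, map_mul, H.conj_conj]
  ring

lemma re_mat_zero_one (H : IsImaginaryQuadratic ι c) (N : RealPlane c) :
    (ι (N.mat 0 1)).re = 0 := by
  obtain ⟨x, y, z, w, -, -, h01, -, -⟩ := N.exists_mat_entries
  rw [h01]
  simp [H.map_conj]
  ring

lemma re_mat_one_zero (H : IsImaginaryQuadratic ι c) (N : RealPlane c) :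
    (ι (N.mat 1 0)).re = 0 := by
  obtain ⟨x, y, z, w, -, -, -, h10, -⟩ := N.exists_mat_entries
  rw [h10]
  simp [H.map_conj]
  ring

lemma mat_norm_equation (H : IsImaginaryQuadratic ι c) (N : RealPlane c) :
    (ι (N.mat 0 0)).re ^ 2 + (ι (N.mat 0 0)).im ^ 2 +
      (ι (N.mat 0 1)).im * (ι (N.mat 1 0)).im = 1 := by
  have h := sl_two_det N.mat
  rw [mat_one_one H] at h
  have := congrArg (fun x => (ι x).re) h
  simp only [map_sub, map_mul, H.map_conj, map_one, Complex.sub_re, Complex.mul_re,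
    Complex.conj_re, Complex.conj_im, Complex.one_re, re_mat_zero_one H,
    re_mat_one_zero H] at this
  linear_combination this

/-- The function whose sign says on which side of the plane `N` the base point at height `2`
above `0` lies. -/
noncomputable def height (ι : R →+* ℂ) (N : RealPlane c) : ℝ :=
  (ι (N.mat 0 1)).im - 4 * (ι (N.mat 1 0)).im

lemma height_smul (H : IsImaginaryQuadratic ι c) (g : SpecialLinearGroup (Fin 2) R)
    (N : RealPlane c) {W : ℂ} (hW : W = starRingEnd ℂ (ι (g 0 0)) * ι (g 0 1) +
      4 * (starRingEnd ℂ (ι (g 1 0)) * ι (g 1 1))) :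
    height ι (g • N) =
      (ι (N.mat 0 1)).im * (Complex.normSq (ι (g 0 0)) + 4 * Complex.normSq (ι (g 1 0))) -
      (ι (N.mat 1 0)).im * (Complex.normSq (ι (g 0 1)) + 4 * Complex.normSq (ι (g 1 1))) -
      2 * ((ι (N.mat 0 0)).im * W.re - (ι (N.mat 0 0)).re * W.im) := by
  have h11 := mat_one_one H N
  have h01 := re_mat_zero_one H N
  have h10 := re_mat_one_zero H N
  obtain ⟨g00, g01, g10, g11⟩ := sl_two_inv_apply (SpecialLinearGroup.map c g)
  simp only [sl_two_map_apply] at g00 g01 g10 g11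
  simp only [height, mat_smul, sl_two_mul_apply, g00, g01, g10, g11, h11, map_add, map_mul,
    map_neg, H.map_conj, hW, Complex.normSq_apply, Complex.add_im, Complex.add_re, Complex.mul_im,
    Complex.mul_re, Complex.neg_im, Complex.neg_re, Complex.conj_re, Complex.conj_im, h01, h10,
    Complex.re_ofNat, Complex.im_ofNat]
  ring

/-- The indicator function of the planes having the base point on their positive side. -/
noncomputable def side (ι : R →+* ℂ) (N : RealPlane c) : ℤ :=
  open Classical in if 0 < height ι N then 1 else 0

lemma exists_crossing_bound (H : IsImaginaryQuadratic ι c) (g : SpecialLinearGroup (Fin 2) R) :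
    ∃ X Y : ℝ, X = Complex.normSq (ι (g 0 0)) + 4 * Complex.normSq (ι (g 1 0)) ∧
      ∀ N : RealPlane c, side ι (g • N) ≠ side ι N →
        4 * ((ι (N.mat 0 0)).re ^ 2 + (ι (N.mat 0 0)).im ^ 2) ≤ X * Y + 4 ∧
        4 * (ι (N.mat 0 1)).im ^ 2 ≤ Y ^ 2 + 16 ∧
        4 * (ι (N.mat 1 0)).im ^ 2 ≤ X ^ 2 + 1 := by
  set X := Complex.normSq (ι (g 0 0)) + 4 * Complex.normSq (ι (g 1 0)) with hXdef
  set Y := Complex.normSq (ι (g 0 1)) + 4 * Complex.normSq (ι (g 1 1)) with hYdef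
  obtain ⟨W, hW⟩ : ∃ W : ℂ, W = starRingEnd ℂ (ι (g 0 0)) * ι (g 0 1) +
      4 * (starRingEnd ℂ (ι (g 1 0)) * ι (g 1 1)) := ⟨_, rfl⟩
  have hdet : X * Y - (W.re ^ 2 + W.im ^ 2) = 4 := by
    have hg := congrArg (fun x => Complex.normSq (ι x)) (sl_two_det g)
    simp only [map_sub, map_mul, map_one, Complex.normSq_apply, Complex.sub_re, Complex.sub_im,
      Complex.mul_re, Complex.mul_im] at hg
    simp only [hXdef, hYdef, hW, Complex.normSq_apply, Complex.add_re, Complex.add_im,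
      Complex.mul_re, Complex.mul_im, Complex.conj_re, Complex.conj_im, Complex.re_ofNat,
      Complex.im_ofNat]
    linear_combination 4 * hg
  have hXnn : 0 ≤ X := add_nonneg (Complex.normSq_nonneg _)
    (mul_nonneg zero_le_four (Complex.normSq_nonneg _))
  have hYnn : 0 ≤ Y := add_nonneg (Complex.normSq_nonneg _)
    (mul_nonneg zero_le_four (Complex.normSq_nonneg _))
  have hXY : 0 < X * Y := by nlinarith [sq_nonneg W.re, sq_nonneg W.im]
  have hX : 0 < X := pos_of_mul_pos_left hXY hYnn
  have hY : 0 < Y := pos_of_mul_pos_right hXY hXnn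
  refine ⟨X, Y, rfl, fun N hN => ?_⟩
  have hs := height_smul H g N hW
  rw [← hXdef, ← hYdef] at hs
  have hnorm := mat_norm_equation H N
  have hsep : 0 < height ι N ∧ height ι (g • N) ≤ 0 ∨
      height ι N ≤ 0 ∧ 0 < height ι (g • N) := by
    simp only [side] at hN
    split_ifs at hN with h1 h2 h2
    · exact absurd rfl hN
    · exact Or.inr ⟨not_lt.1 h2, h1⟩
    · exact Or.inl ⟨h2, not_lt.1 h1⟩
    · exact absurd rfl hN
  rw [hs, height] at hsep
  clear hs hN
  generalize (ι (N.mat 0 0)).re = p₁ at *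
  generalize (ι (N.mat 0 0)).im = p₂ at *
  generalize (ι (N.mat 0 1)).im = q at *
  generalize (ι (N.mat 1 0)).im = r at *
  have key (s : ℝ) :
      0 ≤ s * (q * X - r * Y - 2 * (p₂ * W.re - p₁ * W.im)) ∨ 0 ≤ s * (q - 4 * r) := by
    rcases le_total 0 s with h | h <;> rcases hsep with ⟨h1, h2⟩ | ⟨h1, h2⟩
    · exact Or.inr (mul_nonneg h h1.le)
    · exact Or.inl (mul_nonneg h h2.le)
    · exact Or.inl (mul_nonneg_of_nonpos_of_nonpos h h2)
    · exact Or.inr (mul_nonneg_of_nonpos_of_nonpos h h1)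
  have hr := (key r).imp
    (fun h => crossing_bound hX hY hdet hnorm h)
    (fun h => crossing_bound (X := 1) (Y := 4) (w₁ := 0) (w₂ := 0) (p₁ := p₁) (p₂ := p₂) (q := q)
      (r := r) one_pos zero_lt_four (by norm_num) hnorm (by linear_combination h))
  have hq := (key (-q)).imp
    (fun h => crossing_bound (X := Y) (Y := X) (w₁ := W.re) (w₂ := W.im) (p₁ := p₁) (p₂ := p₂)
      (q := -r) (r := -q) hY hX (by linear_combination hdet) (by linear_combination hnorm)
      (by linear_combination h))
    (fun h => crossing_bound (X := 4) (Y := 1) (w₁ := 0) (w₂ := 0) (p₁ := p₁) (p₂ := p₂) (q := -r)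
      (r := -q) zero_lt_four one_pos (by norm_num) (by linear_combination hnorm)
      (by linear_combination h))
  refine ⟨?_, ?_, ?_⟩
  · rcases hr with ⟨h, -⟩ | ⟨h, -⟩ <;> linarith
  · rcases hq with ⟨-, h⟩ | ⟨-, h⟩ <;> nlinarith
  · rcases hr with ⟨-, h⟩ | ⟨-, h⟩ <;> nlinarith

lemma finite_support_side (H : IsImaginaryQuadratic ι c) (g : SpecialLinearGroup (Fin 2) R) :
    (Function.support fun N : RealPlane c => side ι (g • N) - side ι N).Finite := by
  obtain ⟨X, Y, -, hXY⟩ := exists_crossing_bound H g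
  set B : ℝ := 1 + (X * Y + 4) ^ 2 + Y ^ 2 + 16 + X ^ 2
  have hB {z : ℂ} (hz : 4 * (z.re ^ 2 + z.im ^ 2) ≤ X * Y + 4 ∨
      4 * (z.re ^ 2 + z.im ^ 2) ≤ Y ^ 2 + 16 ∨ 4 * (z.re ^ 2 + z.im ^ 2) ≤ X ^ 2 + 1) :
      ‖z‖ ≤ B := by
    have h : ‖z‖ ^ 2 = z.re ^ 2 + z.im ^ 2 := by
      rw [← Complex.normSq_eq_norm_sq, Complex.normSq_apply]; ring
    rw [← h] at hz
    simp only [B]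
    rcases hz with hz | hz | hz <;> nlinarith [sq_nonneg (‖z‖ - 1), sq_nonneg (X * Y + 4 - 1)]
  have hfin : {f : Fin 2 → Fin 2 → R | ∀ i j, f i j ∈ {x : R | ‖ι x‖ ≤ B}}.Finite :=
    Set.Finite.pi' fun _ => Set.Finite.pi' fun _ => H.finite B
  have hinj : Function.Injective fun (N : RealPlane c) i j => N.mat i j := fun M N h =>
    mat_injective (Matrix.SpecialLinearGroup.ext _ _ fun i j => congrFun (congrFun h i) j)
  refine (hfin.preimage hinj.injOn).subset fun N hN => ?_
  obtain ⟨h00, h01, h10⟩ := hXY N (sub_ne_zero.1 hN)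
  have hB00 : ‖ι (N.mat 0 0)‖ ≤ B := hB (Or.inl h00)
  intro i j
  fin_cases i <;> fin_cases j
  · exact hB00
  · exact hB (Or.inr (Or.inl (by simpa [re_mat_zero_one H] using h01)))
  · exact hB (Or.inr (Or.inr (by simpa [re_mat_one_zero H] using h10)))
  · change ‖ι (N.mat 1 1)‖ ≤ B
    rwa [mat_one_one H, H.map_conj, RCLike.norm_conj]

end RealPlane

/-- The upper unipotent matrix with off-diagonal entry `t`. -/
def upperUnipotent (t : R) : SpecialLinearGroup (Fin 2) R :=
  ⟨!![1, t; 0, 1], by norm_num [Matrix.det_fin_two_of]⟩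

lemma upperUnipotent_mul_neg (t : R) : upperUnipotent t * upperUnipotent (-t) = 1 := by
  refine Matrix.SpecialLinearGroup.ext _ _ fun i j => ?_
  rw [sl_two_mul_apply]
  fin_cases i <;> fin_cases j <;> simp [upperUnipotent]

namespace RealPlane

lemma height_upperUnipotent_smul (H : IsImaginaryQuadratic ι c) (t : R) {N : RealPlane c}
    (h00 : N.mat 0 0 = 1) (h10 : N.mat 1 0 = 0) :
    height ι (upperUnipotent t • N) = height ι N + 2 * (ι t).im := by
  rw [height_smul H _ _ rfl, height, h00, h10]
  simp [upperUnipotent]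

lemma mat_of_side_ne [IsDomain R] [CharZero R] {m : ℕ} {ω : R}
    (H : IsImaginaryQuadratic ι c) (hm_pos : 0 < m) (hm : Squarefree m)
    (hm1 : m ≠ 1) (hm3 : m ≠ 3) (hω : ω ^ 2 = -(m : R)) (hcω : c ω = -ω) {t : R}
    {N : RealPlane c} (hN : side ι (upperUnipotent t • N) ≠ side ι N) :
    N.mat 0 0 = 1 ∧ N.mat 1 0 = 0 := by
  obtain ⟨X, Y, hX, hXY⟩ := exists_crossing_bound H (upperUnipotent t)
  obtain ⟨-, -, hr⟩ := hXY N hN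
  have hX1 : X = 1 := by rw [hX]; simp [upperUnipotent]
  have h10 : N.mat 1 0 = 0 := by
    refine H.eq_zero_of_norm_lt_one ?_
    rw [← sq_lt_one_iff₀ (norm_nonneg _), ← Complex.normSq_eq_norm_sq, Complex.normSq_apply,
      re_mat_one_zero H]
    rw [hX1] at hr
    linarith
  obtain ⟨x, y, z, w, hdet, e00, -, e10, -⟩ := N.exists_mat_entries
  refine ⟨?_, h10⟩
  rw [e00]
  exact H.mul_conj_sub_eq_one hm_pos hm hm1 hm3 hω hcω hdet (sub_eq_zero.1 (e10.symm.trans h10))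

lemma displacement_upperUnipotent_pos [IsDomain R] [CharZero R] {m : ℕ} {ω : R}
    (H : IsImaginaryQuadratic ι c) (hm_pos : 0 < m)
    (hm : Squarefree m) (hm1 : m ≠ 1) (hm3 : m ≠ 3) (hω : ω ^ 2 = -(m : R)) (hcω : c ω = -ω)
    {t : R} (ht : 0 < (ι t).im) :
    0 < ∑ᶠ N : RealPlane c, (side ι (upperUnipotent t • N) - side ι N) := by
  refine finsum_pos (fun N => ?_) ⟨⟨1, 1, by simp⟩, ?_⟩ (finite_support_side H _)
  · by_cases hN : side ι (upperUnipotent t • N) = side ι N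
    · rw [hN, sub_self]
    · obtain ⟨h00, h10⟩ := mat_of_side_ne H hm_pos hm hm1 hm3 hω hcω hN
      have h := height_upperUnipotent_smul H t h00 h10
      unfold side
      split_ifs with h1 h2 h2
      · norm_num
      · norm_num
      · exact absurd (by linarith) h1
      · norm_num
  · set N : RealPlane c := ⟨1, 1, by simp⟩
    have h00 : N.mat 0 0 = 1 := rfl
    have h10 : N.mat 1 0 = 0 := rfl
    have h01 : N.mat 0 1 = 0 := rfl
    have h := height_upperUnipotent_smul H t h00 h10
    have h0 : height ι N = 0 := by simp [height, h01, h10]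
    unfold side
    rw [h, h0, if_pos (by linarith), if_neg (lt_irrefl _)]
    norm_num

end RealPlane

end Side

section Abelianization

variable {R : Type*} [CommRing R] {ι : R →+* ℂ} {c : R →+* R}

lemma not_isOfFinOrder_abelianization_of {G : Type*} [Group G] (φ : G →* Multiplicative ℤ) {g : G}
    (hg : φ g ≠ 1) : ¬ IsOfFinOrder (Abelianization.of g) := fun h => by
  have := (Abelianization.lift φ).isOfFinOrder h
  rw [Abelianization.lift_apply_of] at this
  exact hg (isOfFinOrder_iff_eq_one _ |>.1 this)

lemma not_isOfFinOrder_upperUnipotent [IsDomain R] [CharZero R] {m : ℕ} {ω : R}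
    (H : IsImaginaryQuadratic ι c) (hm_pos : 0 < m)
    (hm : Squarefree m) (hm1 : m ≠ 1) (hm3 : m ≠ 3) (hω : ω ^ 2 = -(m : R)) (hcω : c ω = -ω)
    {t : R} (ht : (ι t).im ≠ 0) :
    ¬ IsOfFinOrder (Abelianization.of (upperUnipotent t)) := by
  set φ := displacementHom (RealPlane.side ι (c := c)) (RealPlane.finite_support_side H)
  have hφ {s : R} (hs : 0 < (ι s).im) : φ (upperUnipotent s) ≠ 1 := fun h =>
    (RealPlane.displacement_upperUnipotent_pos H hm_pos hm hm1 hm3 hω hcω hs).ne' h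
  refine not_isOfFinOrder_abelianization_of φ ?_
  rcases ht.lt_or_gt with ht | ht
  · intro h
    refine hφ (s := -t) (by simpa using ht) ?_
    have h' := congrArg φ (upperUnipotent_mul_neg t)
    rwa [map_mul, h, one_mul, map_one] at h'
  · exact hφ ht

lemma isOfFinOrder_upperUnipotent_intCast (n : ℤ) :
    IsOfFinOrder (Abelianization.of (upperUnipotent (n : R))) := by
  set f : SpecialLinearGroup (Fin 2) ℤ →* Abelianization (SpecialLinearGroup (Fin 2) R) :=
    Abelianization.of.comp (SpecialLinearGroup.map (Int.castRingHom R))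
  have hS : ModularGroup.S ^ 4 = 1 := by decide
  have hST : (ModularGroup.S * ModularGroup.T) ^ 6 = 1 := by decide
  have hT : f ModularGroup.T ^ 12 = 1 := by
    have hS' : f ModularGroup.S ^ 12 = 1 := by
      rw [← map_pow, show 12 = 4 * 3 from rfl, pow_mul, hS, one_pow, map_one]
    have hST' : (f ModularGroup.S * f ModularGroup.T) ^ 12 = 1 := by
      rw [← map_mul, ← map_pow, show 12 = 6 * 2 from rfl, pow_mul, hST, one_pow, map_one]
    rwa [mul_pow, hS', one_mul] at hST'
  have hn : Abelianization.of (upperUnipotent (n : R)) = f ModularGroup.T ^ n := by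
    rw [← map_zpow]
    change _ = Abelianization.of (SpecialLinearGroup.map (Int.castRingHom R) (ModularGroup.T ^ n))
    refine congrArg Abelianization.of (Matrix.SpecialLinearGroup.ext _ _ fun i j => ?_)
    rw [sl_two_map_apply]
    have := congrFun (congrFun (ModularGroup.coe_T_zpow n) i) j
    rw [this]
    fin_cases i <;> fin_cases j <;> simp [upperUnipotent]
  rw [hn]
  exact (isOfFinOrder_iff_pow_eq_one.2 ⟨12, by norm_num, hT⟩).zpow

end Abelianization

section Field

variable {m : ℕ} {K : Type*} [Field K] [NumberField K] {α : K}

lemma exists_eq_add_mul (hα : α ^ 2 = -(m : K)) (hgen : Algebra.adjoin ℚ {α} = ⊤) (x : K) :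
    ∃ p q : ℚ, x = p + q * α := by
  have hx : x ∈ Algebra.adjoin ℚ {α} := hgen ▸ Algebra.mem_top
  induction hx using Algebra.adjoin_induction with
  | mem y hy => exact ⟨0, 1, by simpa using hy⟩
  | algebraMap r => exact ⟨r, 0, by simp⟩
  | add y z _ _ hy hz =>
    obtain ⟨p, q, rfl⟩ := hy
    obtain ⟨r, s, rfl⟩ := hz
    exact ⟨p + r, q + s, by push_cast; ring⟩
  | mul y z _ _ hy hz =>
    obtain ⟨p, q, rfl⟩ := hy
    obtain ⟨r, s, rfl⟩ := hz
    refine ⟨p * r - m * (q * s), p * s + q * r, ?_⟩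
    push_cast
    linear_combination (q * s : K) * hα

lemma embedding_sqrt_neg (hm : 0 < m) (hα : α ^ 2 = -(m : K)) (φ : K →+* ℂ) :
    (φ α).re = 0 ∧ (φ α).im ^ 2 = m := by
  have h : φ α ^ 2 = -(m : ℂ) := by rw [← map_pow, hα, map_neg, map_natCast]
  have hre := congrArg Complex.re h
  have him := congrArg Complex.im h
  simp only [sq, Complex.mul_re, Complex.mul_im, Complex.neg_re, Complex.neg_im,
    Complex.natCast_re, Complex.natCast_im] at hre him
  have hm' : (0 : ℝ) < m := by exact_mod_cast hm
  have hre0 : (φ α).re = 0 := by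
    have : (φ α).re * (φ α).im = 0 := by linarith
    rcases mul_eq_zero.1 this with h0 | h0
    · exact h0
    · rw [h0] at hre
      nlinarith [mul_self_nonneg (φ α).re]
  refine ⟨hre0, ?_⟩
  rw [hre0] at hre
  linarith

lemma norm_embedding_sq (hm : 0 < m) (hα : α ^ 2 = -(m : K)) (φ : K →+* ℂ) (p q : ℚ) :
    ‖φ (p + q * α)‖ ^ 2 = (p : ℝ) ^ 2 + m * (q : ℝ) ^ 2 := by
  obtain ⟨h1, h2⟩ := embedding_sqrt_neg hm hα φ
  rw [← Complex.normSq_eq_norm_sq, Complex.normSq_apply, ← h2]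
  simp [h1]
  ring

lemma exists_conj (hm : 0 < m) (hα : α ^ 2 = -(m : K)) (hgen : Algebra.adjoin ℚ {α} = ⊤)
    (φ : K →+* ℂ) : ∃ σ : K →+* K, ∀ x, φ (σ x) = starRingEnd ℂ (φ x) := by
  have hmem (x : K) : ((starRingEnd ℂ).comp φ) x ∈ φ.range := by
    obtain ⟨p, q, rfl⟩ := exists_eq_add_mul hα hgen x
    refine ⟨p - q * α, ?_⟩
    obtain ⟨h1, -⟩ := embedding_sqrt_neg hm hα φ
    apply Complex.ext <;> simp [h1]
  let e := RingEquiv.ofLeftInverse (Function.leftInverse_invFun φ.injective)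
  refine ⟨e.symm.toRingHom.comp (((starRingEnd ℂ).comp φ).codRestrict φ.range hmem), fun x => ?_⟩
  have : ((e (e.symm (((starRingEnd ℂ).comp φ).codRestrict φ.range hmem x)) : φ.range) : ℂ) =
      starRingEnd ℂ (φ x) := by rw [e.apply_symm_apply]; rfl
  exact this

lemma exists_isImaginaryQuadratic (hm : 0 < m) (hα : α ^ 2 = -(m : K))
    (hgen : Algebra.adjoin ℚ {α} = ⊤) :
    ∃ (ι : 𝓞 K →+* ℂ) (c : 𝓞 K →+* 𝓞 K) (ω : 𝓞 K), IsImaginaryQuadratic ι c ∧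
      ω ^ 2 = -(m : 𝓞 K) ∧ c ω = -ω := by
  obtain ⟨φ⟩ : Nonempty (K →+* ℂ) := inferInstance
  obtain ⟨σ, hσ⟩ := exists_conj hm hα hgen φ
  have hαint : IsIntegral ℤ α := by
    refine IsIntegral.of_pow two_pos ?_
    rw [hα]
    exact (isIntegral_natCast m).neg
  obtain ⟨hre, him⟩ := embedding_sqrt_neg hm hα φ
  have him0 : (φ α).im ≠ 0 := by
    intro h
    rw [h, zero_pow two_ne_zero, eq_comm, Nat.cast_eq_zero] at him
    exact hm.ne' him
  refine ⟨φ.comp (algebraMap (𝓞 K) K), RingOfIntegers.mapRingHom σ, ⟨α, hαint⟩,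
    ⟨φ.injective.comp RingOfIntegers.coe_injective, fun x => hσ x, fun x hx => ?_, fun B => ?_⟩,
    RingOfIntegers.ext ((map_pow _ _ _).trans (hα.trans (by simp))),
    RingOfIntegers.ext (φ.injective ?_)⟩
  · have hx' : σ (x : K) = x := congrArg (algebraMap (𝓞 K) K) hx
    obtain ⟨p, q, hpq⟩ := exists_eq_add_mul hα hgen (x : K)
    have h := hσ (x : K)
    rw [hx', eq_comm, Complex.conj_eq_iff_im, hpq] at h
    have hq : q = 0 := by simpa [him0] using h
    rw [hq, Rat.cast_zero, zero_mul, add_zero] at hpq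
    have hint : IsIntegral ℤ (algebraMap ℚ K p) := by
      have hx := x.isIntegral_coe
      rw [eq_ratCast, ← hpq]
      exact hx
    obtain ⟨n, hn⟩ := IsIntegrallyClosed.isIntegral_iff.1
      ((isIntegral_algebraMap_iff (algebraMap ℚ K).injective).1 hint)
    refine ⟨n, RingOfIntegers.ext ?_⟩
    rw [hpq, ← hn]
    simp
  · refine ((Embeddings.finite_of_norm_le K ℂ B).preimage
      (f := algebraMap (𝓞 K) K) RingOfIntegers.coe_injective.injOn).subset fun x hx => ?_
    refine ⟨x.isIntegral_coe, fun ψ => ?_⟩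
    obtain ⟨p, q, hpq⟩ := exists_eq_add_mul hα hgen (x : K)
    have h : ‖ψ x‖ = ‖φ x‖ := by
      rw [← sq_eq_sq₀ (norm_nonneg _) (norm_nonneg _), hpq, norm_embedding_sq hm hα,
        norm_embedding_sq hm hα]
    exact h.trans_le hx
  · change φ (σ α) = φ (-α)
    rw [hσ]
    apply Complex.ext <;> simp [hre]

end Field

/-- For `m` squarefree positive, `m ≠ 1, 3`, and `𝓞` the ring of integers of
`ℚ(√-m)`: for every `t ∈ 𝓞`, the image of the matrix `[[1,t],[0,1]]` in the abelianization of
the Bianchi group `SL₂(𝓞)` has finite order if and only if `t` lies in the image of the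
canonical map `ℤ → 𝓞`. -/
theorem unipotent_finite_order_in_abelianization_iff_int
    (m : ℕ) (hm_pos : 0 < m) (hm_sqfree : Squarefree m) (hm1 : m ≠ 1) (hm3 : m ≠ 3)
    (K : Type) [Field K] [NumberField K]
    (α : K) (hα : α ^ 2 = -(m : K)) (hgen : Algebra.adjoin ℚ {α} = ⊤)
    (t : 𝓞 K) :
    IsOfFinOrder
        (Abelianization.of (G := Matrix.SpecialLinearGroup (Fin 2) (𝓞 K))
          ⟨!![1, t; 0, 1], by norm_num [Matrix.det_fin_two_of]⟩) ↔
      t ∈ Set.range (algebraMap ℤ (𝓞 K)) := by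
  obtain ⟨ι, c, ω, H, hω, hcω⟩ := exists_isImaginaryQuadratic hm_pos hα hgen
  change IsOfFinOrder (Abelianization.of (upperUnipotent t)) ↔ _
  constructor
  · intro h
    by_contra ht
    refine not_isOfFinOrder_upperUnipotent H hm_pos hm_sqfree hm1 hm3 hω hcω (fun him => ht ?_) h
    obtain ⟨n, hn⟩ := H.mem_range_of_im_eq_zero him
    exact ⟨n, by simpa using hn⟩
  · rintro ⟨n, rfl⟩
    simpa using isOfFinOrder_upperUnipotent_intCast (R := 𝓞 K) n
end

section
/- Let m be a square-free positive integer with m ≠ 1 and m ≠ 3, let 𝓞 be the ring of integers of ℚ(√-m), let ω ∈ 𝓞 satisfy 𝓞 = ℤ[ω], and let Γ = SL₂(𝓞). Let Λ be the subgroup of Γ generated by the matrices γ_x = [[1,1],[0,1]] and γ_y = [[1,ω],[0,1]]. Then the ℚ-linear map ℚ ⊗_ℤ Abelianization(Λ) → ℚ ⊗_ℤ Abelianization(Γ) induced by the inclusion Λ ↪ Γ has a one-dimensional kernel, spanned by the image of 1 ⊗ γ_x. -/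
open NumberField Matrix TensorProduct

/-- A function on a `G`-set which is almost invariant under every element of `G` yields a
homomorphism from `G` to `ℤ`, the total change of the function under translation. -/
theorem exists_hom_of_finite_ne {G X : Type*} [Group G] [MulAction G X] (s : X → ℤ)
    (hs : ∀ g : G, {x | s (g • x) ≠ s x}.Finite) :
    ∃ φ : G →* Multiplicative ℤ, ∀ g, (φ g).toAdd = ∑ᶠ x, (s (g • x) - s x) := by
  have hfin (g : G) : (Function.support fun x ↦ s (g • x) - s x).Finite :=
    (hs g).subset fun x hx ↦ by simpa [sub_eq_zero] using hx
  refine ⟨MonoidHom.mk' (fun g ↦ Multiplicative.ofAdd (∑ᶠ x, (s (g • x) - s x))) ?_, fun g ↦ rfl⟩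
  intro g h
  rw [← ofAdd_add]
  congr 1
  have h1 : ∑ᶠ x, (s (g • h • x) - s (h • x)) = ∑ᶠ x, (s (g • x) - s x) :=
    finsum_comp_equiv (MulAction.toPerm h) (f := fun x ↦ s (g • x) - s x)
  have h2 : (Function.support fun x ↦ s (g • h • x) - s (h • x)).Finite :=
    ((hfin g).preimage (MulAction.injective h).injOn : _)
  rw [← h1, ← finsum_add_distrib h2 (hfin h)]
  exact finsum_congr fun x ↦ by rw [mul_smul]; ring

/-- The action of `G` on complex `2 × 2` matrices by `g • H = ρ(g) H ρ(g)ᴴ`. -/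
@[reducible] def hermitianAction {G : Type*} [Group G] (ρ : G →* SpecialLinearGroup (Fin 2) ℂ) :
    MulAction G (Matrix (Fin 2) (Fin 2) ℂ) where
  smul g H := (ρ g).1 * H * (ρ g).1ᴴ
  one_smul H := show (ρ 1).1 * H * (ρ 1).1ᴴ = H by simp
  mul_smul g h H := show (ρ (g * h)).1 * H * (ρ (g * h)).1ᴴ =
    (ρ g).1 * ((ρ h).1 * H * (ρ h).1ᴴ) * (ρ g).1ᴴ by
      simp [Matrix.mul_assoc]

open ComplexConjugate in
theorem trace_mul_hermitian_mul_re (M : Matrix (Fin 2) (Fin 2) ℂ) (p r : ℝ) (β : ℂ) :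
    (M * !![(p : ℂ), β; star β, (r : ℂ)] * Mᴴ).trace.re =
      p * (Complex.normSq (M 0 0) + Complex.normSq (M 1 0)) +
      r * (Complex.normSq (M 0 1) + Complex.normSq (M 1 1)) +
      2 * (β * (M 0 0 * conj (M 0 1) + M 1 0 * conj (M 1 1))).re := by
  simp [trace_fin_two, Matrix.mul_apply, Fin.sum_univ_two, Complex.normSq_apply]
  ring

open ComplexConjugate in
theorem gram_det_eq_one (M : SpecialLinearGroup (Fin 2) ℂ) :
    (Complex.normSq (M 0 0) + Complex.normSq (M 1 0)) *
      (Complex.normSq (M 0 1) + Complex.normSq (M 1 1)) -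
      Complex.normSq (M 0 0 * conj (M 0 1) + M 1 0 * conj (M 1 1)) = 1 := by
  have h := congrArg Complex.normSq (M.det_coe)
  rw [det_fin_two, map_one] at h
  rw [← h]
  simp [Complex.normSq_apply]
  ring

/-- A Hermitian form of determinant `-1` with entries `p, I * μ, r` which changes sign along a
suitable segment of positive definite forms has `r` and `μ` bounded in terms of the endpoint
with entries `A, B, C`. -/
theorem bounds_of_wall_between {A C p r f : ℝ} {B μ : ℂ} (hA : 0 < A)
    (hdet : A * C - Complex.normSq B = 1) (hμ : Complex.normSq μ - p * r = 1)
    (hf : f = p * A + r * C + 2 * (Complex.I * μ * B).re) (hrf : r * f ≤ 0) :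
    |r| ≤ A ∧ ‖μ‖ ≤ 1 + ‖B‖ := by
  have key : Complex.normSq (A * (Complex.I * μ) + r * star B) ≤ A ^ 2 - r ^ 2 := by
    have : Complex.normSq (A * (Complex.I * μ) + r * star B) = A * (r * f) + A ^ 2 - r ^ 2 := by
      have e : A ^ 2 - r ^ 2 = A ^ 2 * (Complex.normSq μ - p * r) -
        r ^ 2 * (A * C - Complex.normSq B) := by rw [hμ, hdet]; ring
      rw [add_sub_assoc, e, hf]
      simp [Complex.normSq_apply]
      ring
    rw [this]
    nlinarith
  have h0 := Complex.normSq_nonneg (A * (Complex.I * μ) + r * star B)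
  have hr : |r| ≤ A := abs_le_of_sq_le_sq (by linarith) hA.le
  refine ⟨hr, ?_⟩
  have h1 : ‖A * (Complex.I * μ) + r * star B‖ ≤ A := by
    refine le_of_abs_le (abs_le_of_sq_le_sq ?_ hA.le)
    rw [← Complex.normSq_eq_norm_sq]
    linarith [sq_nonneg r]
  have h2 : ‖(A : ℂ) * (Complex.I * μ)‖ ≤ A + |r| * ‖B‖ := by
    have := norm_sub_le (A * (Complex.I * μ) + r * star B) (r * star B)
    rw [add_sub_cancel_right] at this
    refine this.trans ?_
    simp only [norm_mul, norm_star, Complex.norm_real, Real.norm_eq_abs] at h1 ⊢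
    linarith
  simp only [norm_mul, Complex.norm_real, Real.norm_eq_abs, Complex.norm_I, abs_of_pos hA,
    one_mul] at h2
  have h3 : A * ‖μ‖ ≤ A * (1 + ‖B‖) := by nlinarith [norm_nonneg B]
  exact le_of_mul_le_mul_left h3 hA

/-- Hermitian matrices of determinant `-1`, with entries in a lattice, which represent the oriented
totally geodesic planes of hyperbolic 3-space that are translates of the plane over the real line.
The planes through the cusp at infinity (`l = 0`) all carry the same orientation (`μ = 1`). -/
def IsWall (L : Subring ℂ) (y : ℝ) (H : Matrix (Fin 2) (Fin 2) ℂ) : Prop :=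
  ∃ (k l : ℤ) (μ : ℂ), μ ∈ L ∧
    H = !![((2 * y * k : ℝ) : ℂ), Complex.I * μ; star (Complex.I * μ), ((2 * y * l : ℝ) : ℂ)] ∧
    Complex.normSq μ - 2 * y * k * (2 * y * l) = 1 ∧ (l = 0 → μ = 1)

theorem IsWall.mul_trace_pos {L : Subring ℂ} {y : ℝ} (hy : 1 < y) {H : Matrix (Fin 2) (Fin 2) ℂ}
    (hH : IsWall L y H) (h : (H 1 1).re ≠ 0) : 0 < (H 1 1).re * H.trace.re := by
  obtain ⟨k, l, μ, -, rfl, hμ, -⟩ := hH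
  simp only [of_apply, cons_val', cons_val_one, cons_val_fin_one, Complex.ofReal_re,
    trace_fin_two_of, ← Complex.ofReal_add] at h ⊢
  have hl : l ≠ 0 := by rintro rfl; simp at h
  have hl' : (1 : ℝ) ≤ |(l : ℝ)| := by exact_mod_cast Int.one_le_abs hl
  have hr2 : 2 ≤ |2 * y * l| := by
    rw [abs_mul, abs_of_pos (by linarith)]
    nlinarith
  nlinarith [Complex.normSq_nonneg μ, sq_abs (2 * y * l)]

theorem int_of_norm_le_one {L : Subring ℂ} {τ : ℂ} (hτ : 1 < τ.im)
    (hL : ∀ z ∈ L, ∃ u v : ℤ, z = u + v * τ) {z : ℂ} (hz : z ∈ L) (h : ‖z‖ ≤ 1) :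
    ∃ u : ℤ, z = u := by
  obtain ⟨u, v, rfl⟩ := hL z hz
  have h1 := (Complex.abs_im_le_norm _).trans h
  have h2 : |(v : ℝ)| * τ.im ≤ 1 := by
    rw [← abs_of_pos (a := τ.im) (by linarith), ← abs_mul]
    simpa using h1
  have h3 : |(v : ℝ)| < 1 := by nlinarith [abs_nonneg (v : ℝ)]
  have h4 : v = 0 := Int.abs_lt_one_iff.mp (by exact_mod_cast h3)
  exact ⟨u, by simp [h4]⟩

theorem offdiag_eq_one {L : Subring ℂ} {τ : ℂ} (hτ : 1 < τ.im)
    (hL : ∀ z ∈ L, ∃ u v : ℤ, z = u + v * τ) (hconj : ∀ z ∈ L, star z ∈ L)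
    {a b c d : ℂ} (ha : a ∈ L) (hb : b ∈ L) (hc : c ∈ L) (hd : d ∈ L)
    (hdet : a * d - b * c = 1) (hcd : c * star d = d * star c) :
    a * star d - b * star c = 1 := by
  set μ := a * star d - b * star c with hμ
  have hμL : μ ∈ L := L.sub_mem (L.mul_mem ha (hconj d hd)) (L.mul_mem hb (hconj c hc))
  have h1 : μ * c = star c := by linear_combination star c * hdet + a * hcd
  have h2 : μ * d = star d := by linear_combination star d * hdet + b * hcd
  have hn : ‖μ‖ = 1 := by
    by_cases hc0 : c = 0
    · have hd0 : d ≠ 0 := by rintro rfl; simp [hc0] at hdet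
      have := congrArg norm h2
      rw [norm_mul, norm_star] at this
      exact mul_right_cancel₀ (norm_ne_zero_iff.mpr hd0) (by rw [this, one_mul])
    · have := congrArg norm h1
      rw [norm_mul, norm_star] at this
      exact mul_right_cancel₀ (norm_ne_zero_iff.mpr hc0) (by rw [this, one_mul])
  obtain ⟨u, hu⟩ := int_of_norm_le_one hτ hL hμL hn.le
  rw [hu, Complex.norm_intCast] at hn
  have hn' : |u| = 1 := by exact_mod_cast hn
  rcases (abs_eq zero_le_one).mp hn' with rfl | rfl
  · simpa using hu
  exfalso
  have imag : ∀ z ∈ L, μ * z = star z → ∃ v : ℤ, z = Complex.I * τ.im * v := by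
    intro z hz h
    obtain ⟨u, v, rfl⟩ := hL z hz
    refine ⟨v, ?_⟩
    rw [hu] at h
    have := congrArg Complex.re h
    simp at this
    apply Complex.ext
    · simp; linarith
    · simp; ring
  obtain ⟨v, hv⟩ := imag c hc h1
  obtain ⟨w, hw⟩ := imag d hd h2
  have hxL : a * w - b * v ∈ L :=
    L.sub_mem (L.mul_mem ha (intCast_mem L w)) (L.mul_mem hb (intCast_mem L v))
  have hx : Complex.I * τ.im * (a * w - b * v) = 1 := by rw [← hdet, hv, hw]; ring
  have hxn : ‖a * w - b * v‖ ≤ 1 := by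
    have := congrArg norm hx
    rw [norm_mul, norm_mul, Complex.norm_I, Complex.norm_real, Real.norm_of_nonneg (by linarith),
      norm_one] at this
    nlinarith [norm_nonneg (a * w - b * v)]
  obtain ⟨q, hq⟩ := int_of_norm_le_one hτ hL hxL hxn
  rw [hq] at hx
  simpa using congrArg Complex.re hx

theorem isWall_of_mem {L : Subring ℂ} {τ : ℂ} (hτ : 1 < τ.im)
    (hL : ∀ z ∈ L, ∃ u v : ℤ, z = u + v * τ) (hconj : ∀ z ∈ L, star z ∈ L)
    (M : SpecialLinearGroup (Fin 2) ℂ) (hM : ∀ i j, M i j ∈ L) :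
    IsWall L τ.im (M.1 * !![0, Complex.I; -Complex.I, 0] * M.1ᴴ) := by
  have hdet := M.det_coe
  rw [det_fin_two] at hdet
  have him (i : Fin 2) : ∃ k : ℤ, Complex.I * (M i 0 * star (M i 1) - M i 1 * star (M i 0)) =
      (2 * τ.im * k : ℝ) := by
    obtain ⟨u, v, h⟩ := hL _ (L.mul_mem (hM i 1) (hconj _ (hM i 0)))
    refine ⟨v, ?_⟩
    have h' := congrArg star h
    rw [star_mul, star_star] at h'
    rw [h, h']
    apply Complex.ext <;> simp
    ring
  obtain ⟨k, hk⟩ := him 0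
  obtain ⟨l, hl⟩ := him 1
  refine ⟨k, l, M 0 0 * star (M 1 1) - M 0 1 * star (M 1 0), ?_, ?_, ?_, ?_⟩
  · exact L.sub_mem (L.mul_mem (hM _ _) (hconj _ (hM _ _)))
      (L.mul_mem (hM _ _) (hconj _ (hM _ _)))
  · rw [← hk, ← hl]
    ext i j
    fin_cases i <;> fin_cases j <;> simp [Matrix.mul_apply, Fin.sum_univ_two] <;> ring
  · have hd := congrArg star hdet
    simp only [star_sub, star_mul, star_one] at hd
    have : ((Complex.normSq (M 0 0 * star (M 1 1) - M 0 1 * star (M 1 0)) -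
        2 * τ.im * k * (2 * τ.im * l) : ℝ) : ℂ) = 1 := by
      rw [Complex.ofReal_sub, Complex.ofReal_mul, ← hk, ← hl, Complex.normSq_eq_conj_mul_self]
      simp only [← starRingEnd_apply, map_sub, map_mul, Complex.conj_conj] at hd ⊢
      have := Complex.I_sq
      generalize Complex.I = I at *
      linear_combination hdet * ((starRingEnd ℂ) (M 1 1) * (starRingEnd ℂ) (M 0 0) -
        (starRingEnd ℂ) (M 1 0) * (starRingEnd ℂ) (M 0 1)) + hd - this *
        ((M 0 0 * (starRingEnd ℂ) (M 0 1) - M 0 1 * (starRingEnd ℂ) (M 0 0)) *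
        (M 1 0 * (starRingEnd ℂ) (M 1 1) - M 1 1 * (starRingEnd ℂ) (M 1 0)))
    exact_mod_cast this
  · rintro rfl
    refine offdiag_eq_one hτ hL hconj (hM _ _) (hM _ _) (hM _ _) (hM _ _) hdet ?_
    simpa [sub_eq_zero] using hl

theorem finite_isWall_of_norm_le {L : Subring ℂ} {τ : ℂ} (hτ : 1 < τ.im)
    (hL : ∀ z ∈ L, ∃ u v : ℤ, z = u + v * τ) (N : ℝ) :
    {H | IsWall L τ.im H ∧ ∀ i j, ‖H i j‖ ≤ N}.Finite := by
  set n : ℤ := ⌈N + N * ‖τ‖⌉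
  let Φ : ℤ × ℤ × ℤ × ℤ → Matrix (Fin 2) (Fin 2) ℂ := fun q ↦
    !![((2 * τ.im * q.1 : ℝ) : ℂ), Complex.I * (q.2.2.1 + q.2.2.2 * τ);
      star (Complex.I * (q.2.2.1 + q.2.2.2 * τ)), ((2 * τ.im * q.2.1 : ℝ) : ℂ)]
  refine ((Set.finite_Icc ((-n, -n, -n, -n) : ℤ × ℤ × ℤ × ℤ) (n, n, n, n)).image Φ).subset ?_
  rintro H ⟨⟨k, l, μ, hμ, rfl, -, -⟩, hN⟩
  obtain ⟨u, v, rfl⟩ := hL μ hμ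
  refine ⟨(k, l, u, v), ?_, rfl⟩
  have hN0 : 0 ≤ N := (norm_nonneg _).trans (hN 0 0)
  have int_le {j : ℤ} (hj : |(j : ℝ)| ≤ N + N * ‖τ‖) : -n ≤ j ∧ j ≤ n :=
    abs_le.mp (by exact_mod_cast hj.trans (Int.le_ceil _))
  have hτN := mul_nonneg hN0 (norm_nonneg τ)
  have diag {j : ℤ} (hj : ‖((2 * τ.im * j : ℝ) : ℂ)‖ ≤ N) : -n ≤ j ∧ j ≤ n := by
    apply int_le
    rw [Complex.norm_real, Real.norm_eq_abs, abs_mul, abs_of_pos (by linarith)] at hj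
    nlinarith [abs_nonneg (j : ℝ)]
  have hk := diag (hN 0 0)
  have hl := diag (hN 1 1)
  have hμN : ‖(u + v * τ : ℂ)‖ ≤ N := by simpa using hN 0 1
  have hv : |(v : ℝ)| ≤ N := by
    have h2 : |(v : ℝ)| * τ.im ≤ N := by
      rw [← abs_of_pos (a := τ.im) (by linarith), ← abs_mul]
      simpa using (Complex.abs_im_le_norm _).trans hμN
    nlinarith [abs_nonneg (v : ℝ)]
  have hu : |(u : ℝ)| ≤ N + N * ‖τ‖ := by
    have := norm_sub_le (u + v * τ : ℂ) (v * τ)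
    rw [add_sub_cancel_right, Complex.norm_intCast, norm_mul, Complex.norm_intCast] at this
    nlinarith [norm_nonneg τ]
  have hv' := int_le (hv.trans (by linarith))
  have hu' := int_le hu
  simp only [Set.mem_Icc, Prod.mk_le_mk]
  tauto

theorem finite_isWall_crossing {L : Subring ℂ} {τ : ℂ} (hτ : 1 < τ.im)
    (hL : ∀ z ∈ L, ∃ u v : ℤ, z = u + v * τ) (M : SpecialLinearGroup (Fin 2) ℂ) :
    {H | IsWall L τ.im H ∧
      ¬ (0 < (M.1 * H * M.1ᴴ).trace.re ↔ 0 < H.trace.re)}.Finite := by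
  have hdet := gram_det_eq_one M
  have htr := trace_mul_hermitian_mul_re M.1
  set A := Complex.normSq (M 0 0) + Complex.normSq (M 1 0)
  set C := Complex.normSq (M 0 1) + Complex.normSq (M 1 1)
  set B := M 0 0 * (starRingEnd ℂ) (M 0 1) + M 1 0 * (starRingEnd ℂ) (M 1 1)
  have hA : 0 < A := by
    have hA0 : 0 ≤ A := add_nonneg (Complex.normSq_nonneg _) (Complex.normSq_nonneg _)
    refine hA0.lt_of_ne fun h ↦ ?_
    rw [← h] at hdet
    linarith [Complex.normSq_nonneg B]
  have hB0 := norm_nonneg B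
  have hBA : 0 ≤ 2 * ‖B‖ / A := by positivity
  refine (finite_isWall_of_norm_le hτ hL
    (A + ((1 + ‖B‖) ^ 2 + 1) + 2 * ‖B‖ / A)).subset ?_
  rintro H ⟨hH, hne⟩
  refine ⟨hH, ?_⟩
  have hpos := hH.mul_trace_pos hτ
  obtain ⟨k, l, μ, -, rfl, hμ, hl1⟩ := hH
  have hf := htr (2 * τ.im * k) (2 * τ.im * l) (Complex.I * μ)
  rw [hf, trace_fin_two_of, ← Complex.ofReal_add, Complex.ofReal_re] at hne
  suffices hbd : |2 * τ.im * k| ≤ ((1 + ‖B‖) ^ 2 + 1) + 2 * ‖B‖ / A ∧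
      |2 * τ.im * l| ≤ A ∧ ‖μ‖ ≤ 1 + ‖B‖ by
    obtain ⟨h1, h2, h3⟩ := hbd
    intro i j
    fin_cases i <;> fin_cases j <;>
      simp only [Fin.zero_eta, Fin.mk_one, of_apply, cons_val', cons_val_zero, cons_val_one,
        cons_val_fin_one, norm_star, norm_mul Complex.I, Complex.norm_I, one_mul,
        Complex.norm_real, Real.norm_eq_abs] <;> nlinarith
  by_cases hl : l = 0
  · obtain rfl := hl1 hl
    subst hl
    simp only [Int.cast_zero, mul_zero, abs_zero, zero_mul, add_zero, norm_one, mul_one] at hne ⊢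
    refine ⟨?_, hA.le, by linarith⟩
    have hre := (Complex.abs_re_le_norm (Complex.I * B))
    rw [norm_mul, Complex.norm_I, one_mul, abs_le] at hre
    set p := 2 * τ.im * k
    have : |p| ≤ 2 * ‖B‖ / A := by
      rw [le_div_iff₀ hA]
      rcases le_or_gt p 0 with hp | hp
      · rw [abs_of_nonpos hp]
        have : 0 < p * A + 2 * (Complex.I * B).re := by
          by_contra h
          exact hne (iff_of_false h hp.not_gt)
        linarith
      · rw [abs_of_pos hp]
        have : ¬ 0 < p * A + 2 * (Complex.I * B).re := fun h ↦ hne (iff_of_true h hp)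
        linarith
    nlinarith
  · have hl' : (1 : ℝ) ≤ |(l : ℝ)| := by exact_mod_cast Int.one_le_abs hl
    set p := 2 * τ.im * k
    set r := 2 * τ.im * l with hr
    have hr2 : 2 ≤ |r| := by
      rw [hr, abs_mul, abs_of_pos (by linarith)]
      nlinarith
    have hrp : 0 < r * (p + r) := by
      rw [trace_fin_two_of, ← Complex.ofReal_add, Complex.ofReal_re] at hpos
      replace hpos : r ≠ 0 → 0 < r * (p + r) := hpos
      exact hpos (abs_pos.mp (by linarith))
    have hrf : r * (p * A + r * C + 2 * (Complex.I * μ * B).re) ≤ 0 := by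
      by_contra! h
      apply hne
      rcases lt_or_ge 0 r with h0 | h0
      · exact iff_of_true (pos_of_mul_pos_right h h0.le) (pos_of_mul_pos_right hrp h0.le)
      · refine iff_of_false (fun h' ↦ ?_) (fun h' ↦ ?_) <;> nlinarith
    obtain ⟨h1, h2⟩ := bounds_of_wall_between hA hdet hμ rfl hrf
    refine ⟨?_, h1, h2⟩
    have h3 : |p| * |r| ≤ (1 + ‖B‖) ^ 2 + 1 := by
      rw [← abs_mul, show p * r = Complex.normSq μ - 1 by linarith, Complex.normSq_eq_norm_sq,
        abs_le]
      constructor <;> nlinarith [norm_nonneg μ]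
    nlinarith [abs_nonneg p]

/-- The signed number of planes in the orbit of the plane over the real line that separate a base
point from its translate defines a homomorphism which does not vanish on `[[1, τ], [0, 1]]`. -/
theorem exists_hom_ne_one {G : Type*} [Group G] (ρ : G →* SpecialLinearGroup (Fin 2) ℂ)
    {L : Subring ℂ} {τ : ℂ} (hτ : 1 < τ.im)
    (hL : ∀ z ∈ L, ∃ u v : ℤ, z = u + v * τ) (hconj : ∀ z ∈ L, star z ∈ L)
    (hρ : ∀ g i j, ρ g i j ∈ L) {g : G} (hg : (ρ g).1 = !![1, τ; 0, 1]) :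
    ∃ φ : G →* Multiplicative ℤ, φ g ≠ 1 := by
  classical
  let J : Matrix (Fin 2) (Fin 2) ℂ := !![0, Complex.I; -Complex.I, 0]
  let := hermitianAction ρ
  have smul_def (g : G) (H : Matrix (Fin 2) (Fin 2) ℂ) : g • H = (ρ g).1 * H * (ρ g).1ᴴ := rfl
  have hwall (x : MulAction.orbit G J) : IsWall L τ.im x.1 := by
    obtain ⟨_, h, rfl⟩ := x
    exact isWall_of_mem hτ hL hconj (ρ h) (hρ h)
  let s : MulAction.orbit G J → ℤ := fun x ↦ if 0 < x.1.trace.re then 1 else 0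
  have hs (h : G) : {x | s (h • x) ≠ s x}.Finite := by
    refine ((finite_isWall_crossing hτ hL (ρ h)).preimage
      Subtype.val_injective.injOn).subset fun x hx ↦ ⟨hwall x, fun hiff ↦ hx ?_⟩
    simp only [s]
    exact if_congr hiff rfl rfl
  obtain ⟨φ, hφ⟩ := exists_hom_of_finite_ne s hs
  refine ⟨φ, fun h1 ↦ ?_⟩
  have hpos : 0 < ∑ᶠ x, (s (g • x) - s x) := by
    refine finsum_pos (fun x ↦ ?_) ⟨⟨J, MulAction.mem_orbit_self J⟩, ?_⟩
      ((hs g).subset fun x hx ↦ by simpa [sub_eq_zero] using hx)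
    · suffices h : 0 < x.1.trace.re → 0 < (g • x).1.trace.re by
        simp only [s]
        split_ifs <;> simp_all
      intro h
      have h11 : (g • x).1 1 1 = x.1 1 1 := by
        rw [MulAction.orbit.coe_smul, smul_def, hg]
        simp [Matrix.mul_apply, vecMul, dotProduct]
      by_cases h0 : (x.1 1 1).re = 0
      · obtain ⟨k, l, μ, -, he, -, hl1⟩ := hwall x
        have hl : l = 0 := by
          rw [he] at h0
          simpa [(zero_lt_one.trans hτ).ne'] using h0
        rw [MulAction.orbit.coe_smul, smul_def, hg, he, trace_mul_hermitian_mul_re]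
        rw [he, trace_fin_two_of, ← Complex.ofReal_add, Complex.ofReal_re] at h
        simp [hl, hl1 hl] at h ⊢
        linarith
      · have h1 := (hwall x).mul_trace_pos hτ h0
        have h2 := (hwall (g • x)).mul_trace_pos hτ (by rwa [h11])
        rw [h11] at h2
        exact pos_of_mul_pos_right h2 (pos_of_mul_pos_left h1 h.le).le
    · have hJ : J = !![((0 : ℝ) : ℂ), Complex.I; star Complex.I, ((0 : ℝ) : ℂ)] := by simp [J]
      have h1 := trace_mul_hermitian_mul_re !![1, τ; 0, 1] 0 0 Complex.I
      rw [← hJ] at h1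
      simp only [s, MulAction.orbit.coe_smul, smul_def, hg, h1]
      simp [J, zero_lt_one.trans hτ]
  rw [← hφ, h1] at hpos
  exact lt_irrefl _ hpos

open ComplexConjugate in
/-- An embedding of the ring of integers `ℤ[ω]` of `ℚ(√-m)` as a lattice stable under complex
conjugation; apart from the Gaussian and Eisenstein integers, its covolume is greater than one. -/
theorem exists_embedding_one_lt_im {m : ℕ} (hm_sqfree : Squarefree m) (hm1 : m ≠ 1) (hm3 : m ≠ 3)
    {K : Type} [Field K] [NumberField K] {α : K} (hα : α ^ 2 = -(m : K))
    (hgen : Algebra.adjoin ℚ {α} = ⊤) {ω : 𝓞 K}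
    (hω : Algebra.adjoin ℤ ({ω} : Set (𝓞 K)) = ⊤) :
    ∃ σ : 𝓞 K →+* ℂ, 1 < (σ ω).im ∧ (∀ z ∈ σ.range, ∃ u v : ℤ, z = u + v * σ ω) ∧
      ∀ z ∈ σ.range, star z ∈ σ.range := by
  have hm0 : 0 < m := Nat.pos_of_ne_zero hm_sqfree.ne_zero
  have span_rat (φ : K →+* ℂ) (x : K) : ∃ u v : ℚ, φ x = u + v * φ α := by
    have hx : x ∈ Algebra.adjoin ℚ {α} := hgen ▸ Algebra.mem_top
    induction hx using Algebra.adjoin_induction with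
    | mem x hx => exact ⟨0, 1, by simp [Set.mem_singleton_iff.mp hx]⟩
    | algebraMap r => exact ⟨r, 0, by simp⟩
    | add x y _ _ hx hy =>
      obtain ⟨u, v, h⟩ := hx
      obtain ⟨u', v', h'⟩ := hy
      exact ⟨u + u', v + v', by rw [map_add, h, h']; push_cast; ring⟩
    | mul x y _ _ hx hy =>
      obtain ⟨u, v, h⟩ := hx
      obtain ⟨u', v', h'⟩ := hy
      refine ⟨u * u' - m * v * v', u * v' + v * u', ?_⟩
      have h2 : φ α ^ 2 = -m := by rw [← map_pow, hα]; simp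
      rw [map_mul, h, h']
      push_cast
      linear_combination (v * v' : ℂ) * h2
  have alpha_im (φ : K →+* ℂ) : (φ α).re = 0 ∧ (φ α).im ^ 2 = m := by
    have h2 : φ α ^ 2 = -m := by rw [← map_pow, hα]; simp
    have hre := congrArg Complex.re h2
    have him := congrArg Complex.im h2
    simp [pow_two] at hre him
    have hm0' : (0 : ℝ) < m := by exact_mod_cast hm0
    have : (φ α).re = 0 := by
      by_contra h
      have : (φ α).im = 0 := by
        have : (φ α).re * (φ α).im = 0 := by linarith
        simpa [h] using this
      nlinarith
    exact ⟨this, by rw [this] at hre; linarith⟩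
  have hαint : IsIntegral ℤ α := by
    refine IsIntegral.of_pow two_pos ?_
    rw [hα]
    simpa using IsIntegral.neg (isIntegral_algebraMap (R := ℤ) (A := K) (x := (m : ℤ)))
  obtain ⟨φ, hφ⟩ : ∃ φ : K →+* ℂ, 0 ≤ (φ ω).im := by
    obtain ⟨φ⟩ : Nonempty (K →+* ℂ) := inferInstance
    rcases le_total 0 (φ ω).im with h | h
    · exact ⟨φ, h⟩
    · exact ⟨NumberField.ComplexEmbedding.conjugate φ, by simpa using h⟩
  obtain ⟨hre, him⟩ := alpha_im φ
  set τ := φ ω with hτ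
  have hτint : IsIntegral ℤ τ := (RingOfIntegers.isIntegral_coe ω).map φ.toIntAlgHom
  have hτint' : IsIntegral ℤ (conj τ) := hτint.map (starRingEnd ℂ).toIntAlgHom
  obtain ⟨p, q, hpq⟩ := span_rat φ ω
  rw [← hτ] at hpq
  have int_of_rat {r : ℚ} {z : ℂ} (hz : IsIntegral ℤ z) (h : z = r) : ∃ k : ℤ, z = k := by
    have : IsIntegral ℤ (algebraMap ℚ ℂ r) := by rw [h] at hz; simpa using hz
    rw [isIntegral_algebraMap_iff (algebraMap ℚ ℂ).injective,
      IsIntegrallyClosed.isIntegral_iff] at this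
    obtain ⟨k, hk⟩ := this
    exact ⟨k, by rw [h, ← hk]; simp⟩
  have hconjα : conj (φ α) = - φ α := by apply Complex.ext <;> simp [hre]
  have hα2 : φ α ^ 2 = -m := by rw [← map_pow, hα]; simp
  have hpq' : conj τ = p - q * φ α := by rw [hpq]; simp [hconjα]; ring
  obtain ⟨t, ht⟩ := int_of_rat (r := 2 * p) (hτint.add hτint') (by rw [hpq', hpq]; push_cast; ring)
  obtain ⟨n, hn⟩ := int_of_rat (r := p ^ 2 + m * q ^ 2) (hτint.mul hτint') (by
    rw [hpq', hpq]; push_cast; linear_combination -(q : ℂ) ^ 2 * hα2)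
  have hconj : conj τ = t - τ := by rw [← ht]; ring
  have hrel : τ * τ = t * τ - n := by rw [← hn, ← ht]; ring
  have span_int (x : 𝓞 K) : ∃ u v : ℤ, φ x = u + v * τ := by
    have hx : x ∈ Algebra.adjoin ℤ {ω} := hω ▸ Algebra.mem_top
    induction hx using Algebra.adjoin_induction with
    | mem x hx => exact ⟨0, 1, by simp [Set.mem_singleton_iff.mp hx, hτ]⟩
    | algebraMap r => exact ⟨r, 0, by simp⟩
    | add x y _ _ hx hy =>
      obtain ⟨u, v, h⟩ := hx
      obtain ⟨u', v', h'⟩ := hy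
      exact ⟨u + u', v + v', by simp only [map_add, h, h']; push_cast; ring⟩
    | mul x y _ _ hx hy =>
      obtain ⟨u, v, h⟩ := hx
      obtain ⟨u', v', h'⟩ := hy
      refine ⟨u * u' - n * v * v', u * v' + v * u' + t * v * v', ?_⟩
      simp only [map_mul, h, h']
      push_cast
      linear_combination (v * v' : ℂ) * hrel
  refine ⟨φ.comp (algebraMap (𝓞 K) K), ?_, ?_, ?_⟩
  · change 1 < τ.im
    obtain ⟨b₀, b, hb⟩ : ∃ u v : ℤ, φ α = u + v * τ := span_int ⟨α, hαint⟩
    have hm : (m : ℝ) = b ^ 2 * τ.im ^ 2 := by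
      have : (φ α).im = b * τ.im := by simpa using congrArg Complex.im hb
      rw [← him, this]; ring
    have hD : ((4 * n - t ^ 2 : ℤ) : ℝ) = 4 * τ.im ^ 2 := by
      have h1 := congrArg Complex.re ht
      have h2 := congrArg Complex.re hn
      simp at h1 h2
      push_cast
      rw [← h1, ← h2]; ring
    have hmD : 4 * (m : ℤ) = b ^ 2 * (4 * n - t ^ 2) := by
      have : (4 * (m : ℤ) : ℝ) = b ^ 2 * (4 * n - t ^ 2 : ℤ) := by rw [hD]; push_cast; rw [hm]; ring
      exact_mod_cast this
    have hsq : ∀ c : ℤ, c * c ∣ m → c * c = 1 := by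
      intro c hc
      have h := hm_sqfree c.natAbs (by
        rw [← Int.natCast_dvd_natCast]; simpa using hc)
      rw [Nat.isUnit_iff] at h
      rw [← Int.natAbs_mul_self' c, h]; simp
    have hD4 : 4 < 4 * n - t ^ 2 := by
      by_contra! hle
      have hpos : 0 < 4 * n - t ^ 2 := by
        by_contra! h0
        nlinarith [sq_nonneg b]
      have hcase : 4 * n - t ^ 2 = 3 ∨ 4 * n - t ^ 2 = 4 := by
        rcases Int.even_or_odd' t with ⟨s, rfl | rfl⟩ <;> ring_nf at hle hpos ⊢ <;> omega
      rcases hcase with h | h <;> rw [h] at hmD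
      · rcases Int.even_or_odd' b with ⟨c, rfl | rfl⟩
        · have := hsq c ⟨3, by linarith⟩
          apply hm3
          zify; linarith
        · ring_nf at hmD; omega
      · have := hsq b ⟨1, by linarith⟩
        apply hm1
        zify; linarith
    have hD4' : (4 : ℝ) < (4 * n - t ^ 2 : ℤ) := by exact_mod_cast hD4
    nlinarith
  · rintro _ ⟨x, rfl⟩
    exact span_int x
  · rintro _ ⟨x, rfl⟩
    obtain ⟨u, v, h⟩ := span_int x
    refine ⟨u + v * (t - ω), ?_⟩
    change φ _ = conj (φ x)
    rw [h, map_add (conj), map_mul (conj), hconj]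
    simp [hτ]

theorem Abelianization.of_transvection_pow_twelve {R : Type*} [CommRing R]
    {g : SpecialLinearGroup (Fin 2) R} (hg : g.1 = !![1, 1; 0, 1]) :
    Abelianization.of g ^ 12 = 1 := by
  let w : SpecialLinearGroup (Fin 2) R := ⟨!![0, -1; 1, 0], by simp [det_fin_two_of]⟩
  have hw : w.1 = !![0, -1; 1, 0] := rfl
  have h4 : w ^ 4 = 1 := by
    apply Subtype.ext
    change w.1 ^ 4 = 1
    rw [hw]
    simp [pow_succ, one_fin_two]
  have h6 : (w * g) ^ 6 = 1 := by
    apply Subtype.ext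
    change (w.1 * g.1) ^ 6 = 1
    rw [hw, hg]
    simp [pow_succ, one_fin_two]
  have h4' := congrArg Abelianization.of h4
  have h6' := congrArg Abelianization.of h6
  rw [map_pow, map_one] at h4' h6'
  rw [map_mul] at h6'
  calc Abelianization.of g ^ 12
      = (Abelianization.of w ^ 4) ^ 3 * Abelianization.of g ^ 12 := by rw [h4', one_pow, one_mul]
    _ = ((Abelianization.of w * Abelianization.of g) ^ 6) ^ 2 := by
      rw [← pow_mul, ← pow_mul, mul_pow]
    _ = 1 := by rw [h6', one_pow]

theorem one_tmul_ne_zero_of_hom {A V : Type*} [AddCommGroup A] [AddCommGroup V] [Module ℚ V]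
    (f : A →+ V) {a : A} (h : f a ≠ 0) : (1 : ℚ) ⊗ₜ[ℤ] a ≠ 0 := by
  intro h0
  have := congrArg (f.toIntLinearMap.liftBaseChange ℚ) h0
  rw [LinearMap.liftBaseChange_tmul, map_zero, one_smul] at this
  exact h this

/-- The upper right entry, as a homomorphism on a subgroup of matrices with unit diagonal
(which is then a group of triangular matrices in the case of interest). -/
def upperRightHom (R : Type*) [CommRing R] (Λ : Subgroup (SpecialLinearGroup (Fin 2) R))
    (hΛ : ∀ g ∈ Λ, g 0 0 = 1 ∧ g 1 1 = 1) : Λ →* Multiplicative R :=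
  MonoidHom.mk' (fun g ↦ Multiplicative.ofAdd (g.1 0 1)) fun g h ↦ by
    have hg := hΛ g g.2
    have hh := hΛ h h.2
    rw [← ofAdd_add]
    simp [Matrix.mul_apply, Fin.sum_univ_two, hg, hh, add_comm]

theorem diag_eq_one_of_mem_closure {R : Type*} [CommRing R]
    {S : Set (SpecialLinearGroup (Fin 2) R)} (hS : ∀ g ∈ S, ∃ x, g.1 = !![1, x; 0, 1])
    {g : SpecialLinearGroup (Fin 2) R} (hg : g ∈ Subgroup.closure S) :
    ∃ x, g.1 = !![1, x; 0, 1] := by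
  induction hg using Subgroup.closure_induction with
  | mem g hg => exact hS g hg
  | one => exact ⟨0, by simp [one_fin_two]⟩
  | mul g h _ _ hg hh =>
    obtain ⟨x, hx⟩ := hg
    obtain ⟨y, hy⟩ := hh
    exact ⟨y + x, by simp [hx, hy]⟩
  | inv g _ hg =>
    obtain ⟨x, hx⟩ := hg
    exact ⟨-x, by simp [hx, adjugate_fin_two_of]⟩

theorem span_one_tmul_generators {G : Type*} [Group G] {x y : G} (Λ : Subgroup G)
    (hΛ : Λ = Subgroup.closure {x, y}) (hx : x ∈ Λ) (hy : y ∈ Λ)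
    (z : ℚ ⊗[ℤ] Additive (Abelianization Λ)) :
    ∃ a b : ℚ, z = a • (1 : ℚ) ⊗ₜ[ℤ] Additive.ofMul (Abelianization.of (⟨x, hx⟩ : Λ)) +
      b • (1 : ℚ) ⊗ₜ[ℤ] Additive.ofMul (Abelianization.of (⟨y, hy⟩ : Λ)) := by
  set X := (1 : ℚ) ⊗ₜ[ℤ] Additive.ofMul (Abelianization.of (⟨x, hx⟩ : Λ)) with hX
  set Y := (1 : ℚ) ⊗ₜ[ℤ] Additive.ofMul (Abelianization.of (⟨y, hy⟩ : Λ)) with hY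
  suffices h : ∀ g (hg : g ∈ Λ),
      (1 : ℚ) ⊗ₜ[ℤ] Additive.ofMul (Abelianization.of (⟨g, hg⟩ : Λ)) ∈ Submodule.span ℚ {X, Y} by
    suffices hz : z ∈ Submodule.span ℚ {X, Y} by
      obtain ⟨a, b, h⟩ := Submodule.mem_span_pair.mp hz
      exact ⟨a, b, h.symm⟩
    induction z with
    | zero => exact zero_mem _
    | add z w hz hw => exact add_mem hz hw
    | tmul q a =>
      obtain ⟨g, hg⟩ := QuotientGroup.mk_surjective a.toMul
      have ha : a = Additive.ofMul (Abelianization.of g) := congrArg Additive.ofMul hg.symm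
      rw [ha, ← mul_one q, ← smul_eq_mul, ← TensorProduct.smul_tmul']
      exact Submodule.smul_mem _ _ (h g.1 g.2)
  intro g hg
  have hg' : g ∈ Subgroup.closure {x, y} := hΛ ▸ hg
  induction hg' using Subgroup.closure_induction with
  | mem g h =>
    rcases h with rfl | rfl
    · exact Submodule.subset_span (by simp [hX])
    · exact Submodule.subset_span (by simp [hY])
  | one =>
    have : (⟨1, hg⟩ : Λ) = 1 := rfl
    rw [this, map_one, ofMul_one, TensorProduct.tmul_zero]
    exact zero_mem _
  | mul g h hg₁ hh₁ hg₂ hh₂ =>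
    rw [← hΛ] at hg₁ hh₁
    have : (⟨g * h, hg⟩ : Λ) = ⟨g, hg₁⟩ * ⟨h, hh₁⟩ := rfl
    rw [this, map_mul, ofMul_mul, TensorProduct.tmul_add]
    exact add_mem (hg₂ hg₁) (hh₂ hh₁)
  | inv g hg₁ hg₂ =>
    rw [← hΛ] at hg₁
    have : (⟨g⁻¹, hg⟩ : Λ) = ⟨g, hg₁⟩⁻¹ := rfl
    rw [this, map_inv, ofMul_inv, TensorProduct.tmul_neg]
    exact neg_mem (hg₂ hg₁)

/-- Let `m` be squarefree positive, `m ≠ 1, 3`, `𝓞` the ring of integers of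
`ℚ(√-m)`, `ω ∈ 𝓞` with `𝓞 = ℤ[ω]`, and `Γ = SL₂(𝓞)`. Let `Λ` be the subgroup of `Γ` generated
by `γx = [[1,1],[0,1]]` and `γy = [[1,ω],[0,1]]`. Then the ℚ-linear map
`ℚ ⊗_ℤ Abelianization(Λ) → ℚ ⊗_ℤ Abelianization(Γ)` induced by the inclusion has a
one-dimensional kernel, spanned by the image of `1 ⊗ γx`. -/
theorem kernel_of_cusp_inclusion_on_rational_homology
    (m : ℕ) (hm_pos : 0 < m) (hm_sqfree : Squarefree m) (hm1 : m ≠ 1) (hm3 : m ≠ 3)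
    (K : Type) [Field K] [NumberField K]
    (α : K) (hα : α ^ 2 = -(m : K)) (hgen : Algebra.adjoin ℚ {α} = ⊤)
    (ω : 𝓞 K) (hω : Algebra.adjoin ℤ ({ω} : Set (𝓞 K)) = ⊤)
    (γx γy : Matrix.SpecialLinearGroup (Fin 2) (𝓞 K))
    (hγx : γx.1 = !![1, 1; 0, 1]) (hγy : γy.1 = !![1, ω; 0, 1])
    (Λ : Subgroup (Matrix.SpecialLinearGroup (Fin 2) (𝓞 K)))
    (hΛ : Λ = Subgroup.closure {γx, γy})
    (hx : γx ∈ Λ) :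
    LinearMap.ker
        (((MonoidHom.toAdditive (Abelianization.map Λ.subtype)).toIntLinearMap).baseChange ℚ) =
      Submodule.span ℚ
        {(1 : ℚ) ⊗ₜ[ℤ] Additive.ofMul (Abelianization.of (⟨γx, hx⟩ : Λ))} ∧
    (1 : ℚ) ⊗ₜ[ℤ] Additive.ofMul (Abelianization.of (⟨γx, hx⟩ : Λ)) ≠ 0 := by
  obtain ⟨σ, hτ, hL, hconj⟩ := exists_embedding_one_lt_im hm_sqfree hm1 hm3 hα hgen hω
  obtain ⟨φ, hφ⟩ := exists_hom_ne_one (SpecialLinearGroup.map σ) hτ hL hconj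
    (fun g i j ↦ ⟨g i j, by simp⟩) (g := γy) (by
      rw [SpecialLinearGroup.map_apply_coe, hγy]
      ext i j
      fin_cases i <;> fin_cases j <;> simp)
  have hy : γy ∈ Λ := hΛ ▸ Subgroup.subset_closure (by simp)
  have hunip (g) (hg : g ∈ Λ) : ∃ x, g.1 = !![1, x; 0, 1] := by
    rw [hΛ] at hg
    refine diag_eq_one_of_mem_closure ?_ hg
    rintro _ (rfl | rfl)
    exacts [⟨1, hγx⟩, ⟨ω, hγy⟩]
  have hx0 : (1 : ℚ) ⊗ₜ[ℤ] Additive.ofMul (Abelianization.of γx) = 0 := by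
    have h := congrArg Additive.ofMul (Abelianization.of_transvection_pow_twelve hγx)
    rw [ofMul_pow, ofMul_one] at h
    have h' : (12 : ℚ) • (1 : ℚ) ⊗ₜ[ℤ] Additive.ofMul (Abelianization.of γx) = 0 := by
      rw [ofNat_smul_eq_nsmul, ← TensorProduct.tmul_smul, h, TensorProduct.tmul_zero]
    exact (smul_eq_zero.mp h').resolve_left (by norm_num)
  have hy0 : (1 : ℚ) ⊗ₜ[ℤ] Additive.ofMul (Abelianization.of γy) ≠ 0 := by
    refine one_tmul_ne_zero_of_hom
      ((Int.castAddHom ℚ).comp (MonoidHom.toAdditiveLeft (Abelianization.lift φ))) ?_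
    simpa using hφ
  refine ⟨le_antisymm (fun z hz ↦ ?_) ?_, ?_⟩
  · obtain ⟨a, b, rfl⟩ := span_one_tmul_generators Λ hΛ hx hy z
    have hz' : a • (1 : ℚ) ⊗ₜ[ℤ] Additive.ofMul (Abelianization.of γx) +
        b • (1 : ℚ) ⊗ₜ[ℤ] Additive.ofMul (Abelianization.of γy) = 0 := by
      rw [LinearMap.mem_ker, map_add, map_smul, map_smul] at hz
      exact hz
    rw [hx0, smul_zero, zero_add, smul_eq_zero_iff_left hy0] at hz'
    rw [hz', zero_smul, add_zero]
    exact Submodule.smul_mem _ _ (Submodule.mem_span_singleton_self _)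
  · rw [Submodule.span_singleton_le_iff_mem, LinearMap.mem_ker]
    exact hx0
  · let u := upperRightHom (𝓞 K) Λ fun g hg ↦ by
      obtain ⟨x, h⟩ := hunip g hg
      simp [h]
    refine one_tmul_ne_zero_of_hom
      (σ.toAddMonoidHom.comp (MonoidHom.toAdditiveLeft (Abelianization.lift u))) ?_
    simp [u, upperRightHom, hγx]
end
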